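/- Let ζ ∈ 𝕋 and let n ≥ 1 be an integer. If c_μ({ζ}) = 0, then the polynomial (z − ζ)ⁿ is cyclic for D(μ), i.e. [(z − ζ)ⁿ]_{D(μ)} = D(μ). -/

import Mathlib

open MeasureTheory Metric Filter Complex Set
open scoped ENNReal Topology

noncomputable section

namespace DirichletMu

/-- The open unit disc in `ℂ`. -/
def disc : Set ℂ := Metric.ball 0 1

/-- The unit circle `𝕋`. -/
def circleT : Set ℂ := Metric.sphere 0 1

/-- The boundary point `e^{it}`. -/
def bpt (t : ℝ) : ℂ := Complex.exp (Complex.I * (t : ℂ))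

/-- Arc-length parametrizing measure on `(0, 2π]`. -/
def θm : Measure ℝ := volume.restrict (Set.Ioc 0 (2 * Real.pi))

/-- A measure is carried by the unit circle. -/
def OnCircle (μ : Measure ℂ) : Prop := μ circleTᶜ = 0

/-- The mean-square integrals of `f` over circles of radius `r < 1`. -/
def hardySet (f : ℂ → ℂ) : Set ℝ :=
  {x | ∃ r : ℝ, 0 < r ∧ r < 1 ∧
    x = (1 / (2 * Real.pi)) * ∫ t in (0:ℝ)..(2 * Real.pi), ‖f ((r : ℂ) * bpt t)‖ ^ 2}

/-- Membership in the Hardy space `H²`. -/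
def MemHardy2 (f : ℂ → ℂ) : Prop :=
  DifferentiableOn ℂ f disc ∧ BddAbove (hardySet f)

/-- The squared Hardy norm. -/
def hardyNormSq (f : ℂ → ℂ) : ℝ := sSup (hardySet f)

/-- Membership in `H^∞`. -/
def MemHinf (f : ℂ → ℂ) : Prop :=
  DifferentiableOn ℂ f disc ∧ ∃ C : ℝ, ∀ z ∈ disc, ‖f z‖ ≤ C

/-- The sup norm over the disc. -/
def supNorm (f : ℂ → ℂ) : ℝ := sSup ((fun z => ‖f z‖) '' disc)

/-- The Poisson integral of the measure `μ`. -/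
def poissonMu (μ : Measure ℂ) (z : ℂ) : ℝ :=
  ∫ ζ, (1 - ‖z‖ ^ 2) / ‖1 - (starRingEnd ℂ) ζ * z‖ ^ 2 ∂μ

/-- The integrand of the Dirichlet integral. -/
def dirichletDensity (μ : Measure ℂ) (f : ℂ → ℂ) (z : ℂ) : ℝ :=
  ‖deriv f z‖ ^ 2 * poissonMu μ z

/-- The Dirichlet integral `D_μ(f)`. -/
def dirichletIntegral (μ : Measure ℂ) (f : ℂ → ℂ) : ℝ :=
  (1 / Real.pi) * ∫ z in disc, dirichletDensity μ f z

/-- Membership in the Dirichlet-type space `D(μ)`. -/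
def MemD (μ : Measure ℂ) (f : ℂ → ℂ) : Prop :=
  MemHardy2 f ∧ IntegrableOn (dirichletDensity μ f) disc

/-- The squared norm `‖f‖_μ²` of `D(μ)`. -/
def dNormSq (μ : Measure ℂ) (f : ℂ → ℂ) : ℝ :=
  hardyNormSq f + dirichletIntegral μ f

/-- `f` has radial limit `L` at `ζ`. -/
def HasRadialLimitAt (f : ℂ → ℂ) (ζ L : ℂ) : Prop :=
  Tendsto (fun r : ℝ => f ((r : ℂ) * ζ)) (nhdsWithin 1 (Set.Iio 1)) (nhds L)

/-- The modulus of `f` has radial limit `m` at `e^{it}`. -/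
def BoundaryAbs (f : ℂ → ℂ) (t : ℝ) (m : ℝ) : Prop :=
  Tendsto (fun r : ℝ => ‖f ((r : ℂ) * bpt t)‖) (nhdsWithin 1 (Set.Iio 1)) (nhds m)

/-- The boundary zero set `Z_𝕋(f)`. -/
def ZT (f : ℂ → ℂ) : Set ℂ :=
  {ζ | ζ ∈ circleT ∧ HasRadialLimitAt f ζ 0}

/-- The set `Z̲(f)`. -/
def Zlow (f : ℂ → ℂ) : Set ℂ :=
  {ζ | ζ ∈ Metric.closedBall (0 : ℂ) 1 ∧
    Filter.liminf (fun z => ‖f z‖) (nhdsWithin ζ disc) = 0}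

def ZlowSet (S : Set (ℂ → ℂ)) : Set ℂ := ⋂ f ∈ S, Zlow f

def ZTSet (S : Set (ℂ → ℂ)) : Set ℂ := ⋂ f ∈ S, ZT f

/-- `[f]_{D(μ)}`: the closure in `D(μ)` of the polynomial multiples of `f`. -/
def closedSpan (μ : Measure ℂ) (f : ℂ → ℂ) : Set (ℂ → ℂ) :=
  {g | MemD μ g ∧ ∀ ε > 0, ∃ q : Polynomial ℂ,
    dNormSq μ (fun z => g z - q.eval z * f z) < ε}

/-- `f` is cyclic for `D(μ)`. -/
def IsCyclic (μ : Measure ℂ) (f : ℂ → ℂ) : Prop :=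
  closedSpan μ f = {g | MemD μ g}

/-- `f` is the outer function with boundary modulus `φ` (parametrized by `e^{it}`). -/
def OuterWith (f : ℂ → ℂ) (φ : ℝ → ℝ) : Prop :=
  (∀ t, 0 ≤ φ t) ∧
  IntervalIntegrable (fun t => Real.log (φ t)) volume 0 (2 * Real.pi) ∧
  ∀ z ∈ disc, f z = Complex.exp (((2 * Real.pi : ℝ) : ℂ)⁻¹ *
    ∫ t in (0:ℝ)..(2 * Real.pi), ((bpt t + z) / (bpt t - z)) * (Real.log (φ t) : ℂ))

/-- `f` is an outer function. -/
def IsOuter (f : ℂ → ℂ) : Prop := ∃ φ, OuterWith f φ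

/-- Inner functions. -/
def IsInner (f : ℂ → ℂ) : Prop :=
  DifferentiableOn ℂ f disc ∧ (∀ z ∈ disc, ‖f z‖ ≤ 1) ∧
  ∀ᵐ t ∂θm, BoundaryAbs f t 1

/-- `f / Θ ∈ H²`. -/
def InnerDivides (Θ f : ℂ → ℂ) : Prop :=
  ∃ g, MemHardy2 g ∧ ∀ z ∈ disc, f z = Θ z * g z

/-- `Θ / Θ'` is bounded on the disc. -/
def DividesBdd (Θ' Θ : ℂ → ℂ) : Prop :=
  ∃ g, MemHinf g ∧ ∀ z ∈ disc, Θ z = Θ' z * g z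

/-- `Θ` is the greatest common inner divisor of the family `M`. -/
def IsGCDInner (M : Set (ℂ → ℂ)) (Θ : ℂ → ℂ) : Prop :=
  IsInner Θ ∧ (∀ f ∈ M, InnerDivides Θ f) ∧
  ∀ Θ', IsInner Θ' → (∀ f ∈ M, InnerDivides Θ' f) → DividesBdd Θ' Θ

/-- The set `Θ H²`. -/
def innerMulH2 (Θ : ℂ → ℂ) : Set (ℂ → ℂ) :=
  {h | ∃ g, MemHardy2 g ∧ ∀ z ∈ disc, h z = Θ z * g z}

/-- Poisson extension of a boundary function (parametrized by `e^{it}`). -/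
def poissonExt (u : ℝ → ℝ) (z : ℂ) : ℝ :=
  (1 / (2 * Real.pi)) * ∫ t in (0:ℝ)..(2 * Real.pi),
    ((1 - ‖z‖ ^ 2) / ‖bpt t - z‖ ^ 2) * u t

/-- `|∇ P[u]|² P_μ`. -/
def gradDensity (μ : Measure ℂ) (u : ℝ → ℝ) (z : ℂ) : ℝ :=
  ‖fderiv ℝ (poissonExt u) z‖ ^ 2 * poissonMu μ z

/-- Membership in the harmonic Dirichlet space `D^h(μ)`. -/
def MemDh (μ : Measure ℂ) (u : ℝ → ℝ) : Prop :=
  IntegrableOn (fun t => (u t) ^ 2) (Set.Ioc 0 (2 * Real.pi)) volume ∧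
  IntegrableOn (gradDensity μ u) disc

/-- The squared norm of `D^h(μ)`. -/
def dhNormSq (μ : Measure ℂ) (u : ℝ → ℝ) : ℝ :=
  (1 / (2 * Real.pi)) * (∫ t in Set.Ioc 0 (2 * Real.pi), (u t) ^ 2) +
  (1 / Real.pi) * ∫ z in disc, gradDensity μ u z

/-- Relatively open subsets of the circle. -/
def RelOpen (U : Set ℂ) : Prop := ∃ V : Set ℂ, IsOpen V ∧ U = V ∩ circleT

/-- Capacity of a relatively open subset of the circle. -/
def capOpen (μ : Measure ℂ) (U : Set ℂ) : ℝ≥0∞ :=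
  ⨅ (u : ℝ → ℝ) (_ : MemDh μ u ∧ (∀ t, 0 ≤ u t) ∧
      ∀ᵐ t ∂θm, bpt t ∈ U → 1 ≤ u t),
    ENNReal.ofReal (dhNormSq μ u)

/-- The capacity `c_μ` of an arbitrary subset of the circle. -/
def cap (μ : Measure ℂ) (F : Set ℂ) : ℝ≥0∞ :=
  ⨅ (U : Set ℂ) (_ : RelOpen U ∧ F ⊆ U), capOpen μ U

/-- The (closed) support of a measure on `ℂ`. -/
def msupport (μ : Measure ℂ) : Set ℂ :=
  {x | ∀ r > 0, 0 < μ (Metric.ball x r)}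

/-- `M_μ(E)`: functions of `D(μ)` whose radial limits vanish `c_μ`-q.e. on `E`. -/
def Mspace (μ : Measure ℂ) (E : Set ℂ) : Set (ℂ → ℂ) :=
  {g | MemD μ g ∧ ∃ N : Set ℂ, cap μ N = 0 ∧ ∀ ζ ∈ E \ N, HasRadialLimitAt g ζ 0}

/-- Closed shift-invariant subspaces of `D(μ)` (closedness for the `D(μ)` norm). -/
structure ClosedInvSubspace (μ : Measure ℂ) (M : Set (ℂ → ℂ)) : Prop where
  subset : M ⊆ {f | MemD μ f}
  zero_mem : (fun _ => (0 : ℂ)) ∈ M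
  add_mem : ∀ f ∈ M, ∀ g ∈ M, (fun z => f z + g z) ∈ M
  smul_mem : ∀ (c : ℂ), ∀ f ∈ M, (fun z => c * f z) ∈ M
  shift_mem : ∀ f ∈ M, (fun z => z * f z) ∈ M
  closed : ∀ g, MemD μ g →
    (∀ ε > 0, ∃ h ∈ M, dNormSq μ (fun z => g z - h z) < ε) → g ∈ M

/-- The norm `‖f‖_{∞,μ}` of the Banach algebra `D(μ) ∩ H^∞`. -/
def algNorm (μ : Measure ℂ) (f : ℂ → ℂ) : ℝ :=
  supNorm f + Real.sqrt (dirichletIntegral μ f)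

/-- Membership in the Banach algebra `D(μ) ∩ H^∞`. -/
def MemA (μ : Measure ℂ) (f : ℂ → ℂ) : Prop := MemD μ f ∧ MemHinf f

/-- Closed ideals of `D(μ) ∩ H^∞`. -/
structure ClosedIdeal (μ : Measure ℂ) (J : Set (ℂ → ℂ)) : Prop where
  subset : J ⊆ {f | MemA μ f}
  zero_mem : (fun _ => (0 : ℂ)) ∈ J
  add_mem : ∀ f ∈ J, ∀ g ∈ J, (fun z => f z + g z) ∈ J
  mul_mem : ∀ f, MemA μ f → ∀ g ∈ J, (fun z => f z * g z) ∈ J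
  closed : ∀ g, MemA μ g →
    (∀ ε > 0, ∃ h ∈ J, algNorm μ (fun z => g z - h z) < ε) → g ∈ J

/-- A multiplier of `D(μ)`. -/
def IsMultiplier (μ : Measure ℂ) (φ : ℂ → ℂ) : Prop :=
  DifferentiableOn ℂ φ disc ∧ ∀ g, MemD μ g → MemD μ (fun z => φ z * g z)

/-- Distance between two subsets of `ℂ`. -/
def setDist (A B : Set ℂ) : ℝ :=
  sInf ((fun p : ℂ × ℂ => dist p.1 p.2) '' (A ×ˢ B))

/-- The Poisson kernel with pole `ξ` on the circle, as an extended nonnegative real. -/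
def pk (ξ z : ℂ) : ℝ≥0∞ := ENNReal.ofReal ((1 - ‖z‖ ^ 2) / ‖ξ - z‖ ^ 2)

/-- The Poisson integral of `μ`, as an extended nonnegative real. -/
def W (μ : Measure ℂ) (z : ℂ) : ℝ≥0∞ := ∫⁻ ξ, pk ξ z ∂μ

lemma measurable_pk : Measurable (fun p : ℂ × ℂ => pk p.1 p.2) := by
  unfold pk; fun_prop

lemma measurable_W (μ : Measure ℂ) [SFinite μ] : Measurable (W μ) :=
  measurable_pk.lintegral_prod_left'

lemma norm_one_sub_conj_mul {ξ : ℂ} (hξ : ‖ξ‖ = 1) (z : ℂ) :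
    ‖1 - (starRingEnd ℂ) ξ * z‖ = ‖ξ - z‖ := by
  have h : (starRingEnd ℂ) ξ * ξ = 1 := by
    rw [mul_comm, Complex.mul_conj, Complex.normSq_eq_norm_sq, hξ]; simp
  have : 1 - (starRingEnd ℂ) ξ * z = (starRingEnd ℂ) ξ * (ξ - z) := by rw [mul_sub, h]
  rw [this, norm_mul, RCLike.norm_conj, hξ, one_mul]

lemma ae_norm_eq_one {μ : Measure ℂ} (hμ : OnCircle μ) : ∀ᵐ ξ ∂μ, ‖ξ‖ = 1 := by
  have : ∀ᵐ ξ ∂μ, ξ ∈ circleT := by rw [ae_iff]; exact hμ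
  filter_upwards [this] with ξ hξ
  simpa [circleT] using hξ

lemma ofReal_poissonMu {μ : Measure ℂ} [IsFiniteMeasure μ] (hμ : OnCircle μ) {z : ℂ}
    (hz : ‖z‖ < 1) : ENNReal.ofReal (poissonMu μ z) = W μ z := by
  have hz' : 0 ≤ 1 - ‖z‖ ^ 2 := by nlinarith [norm_nonneg z]
  rw [poissonMu, W, ofReal_integral_eq_lintegral_ofReal]
  · refine lintegral_congr_ae ?_
    filter_upwards [ae_norm_eq_one hμ] with ξ hξ
    rw [pk, norm_one_sub_conj_mul hξ]
  · refine Integrable.of_bound (C := (1 - ‖z‖ ^ 2) / (1 - ‖z‖) ^ 2) ?_ ?_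
    · exact Measurable.aestronglyMeasurable (by fun_prop)
    · filter_upwards [ae_norm_eq_one hμ] with ξ hξ
      rw [norm_one_sub_conj_mul hξ, Real.norm_of_nonneg (by positivity)]
      have : 1 - ‖z‖ ≤ ‖ξ - z‖ := by rw [← hξ]; exact norm_sub_norm_le _ _
      have h1 : 0 < 1 - ‖z‖ := by linarith
      gcongr
  · exact Eventually.of_forall fun ξ => by positivity

lemma poissonMu_nonneg (μ : Measure ℂ) {z : ℂ} (hz : ‖z‖ < 1) : 0 ≤ poissonMu μ z := by
  have hz' : 0 ≤ 1 - ‖z‖ ^ 2 := by nlinarith [norm_nonneg z]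
  exact integral_nonneg fun ξ => by positivity

lemma lintegral_ball_polar {f : ℂ → ℝ≥0∞} (hf : Measurable f) (a : ℂ) (R : ℝ) :
    ∫⁻ z in ball a R, f z =
      ∫⁻ r in Ioo 0 R, ENNReal.ofReal r * ∫⁻ θ in Ioo (-Real.pi) Real.pi, f (circleMap a r θ) := by
  have hm : Measurable fun p : ℝ × ℝ => circleMap a p.1 p.2 := by
    unfold circleMap; fun_prop
  rw [← lintegral_indicator measurableSet_ball,
    ← lintegral_add_left_eq_self _ a, ← Complex.lintegral_comp_polarCoord_symm, polarCoord_target,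
    Measure.volume_eq_prod, setLIntegral_prod _ ?_]
  · rw [← lintegral_indicator measurableSet_Ioo, ← lintegral_indicator measurableSet_Ioi]
    refine lintegral_congr fun r => ?_
    by_cases hr : 0 < r
    · rw [indicator_of_mem (show r ∈ Ioi 0 from hr)]
      have hc : ∀ θ : ℝ, a + Complex.polarCoord.symm (r, θ) = circleMap a r θ := fun θ => by
        rw [Complex.polarCoord_symm_apply, circleMap, Complex.exp_mul_I]
        push_cast; ring
      have hb : ∀ θ : ℝ, circleMap a r θ ∈ ball a R ↔ r < R := fun θ => by
        simp [mem_ball, dist_eq_norm, circleMap, abs_of_pos hr]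
      simp_rw [hc, smul_eq_mul]
      by_cases hR : r < R
      · rw [indicator_of_mem (show r ∈ Ioo 0 R from ⟨hr, hR⟩)]
        simp_rw [indicator_of_mem ((hb _).2 hR)]
        rw [lintegral_const_mul]
        exact hf.comp (hm.comp measurable_prodMk_left)
      · rw [indicator_of_notMem (fun h => hR h.2)]
        have h0 : ∀ θ : ℝ, (ball a R).indicator f (circleMap a r θ) = 0 := fun θ =>
          indicator_of_notMem (fun h => hR ((hb θ).1 h)) _
        simp [h0]
    · rw [indicator_of_notMem (show r ∉ Ioi 0 from hr),
        indicator_of_notMem (fun h => hr h.1)]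
  · refine (Measurable.mul (by fun_prop) ?_).aemeasurable
    refine (hf.indicator measurableSet_ball).comp (measurable_const.add ?_)
    have : (Complex.polarCoord.symm : ℝ × ℝ → ℂ) =
        fun p => p.1 * (Real.cos p.2 + Real.sin p.2 * Complex.I) :=
      funext Complex.polarCoord_symm_apply
    rw [this]
    fun_prop

lemma lintegral_ball_inv_norm_sub (a : ℂ) (R : ℝ) :
    ∫⁻ z in ball a R, ENNReal.ofReal (1 / ‖a - z‖) = ENNReal.ofReal (2 * Real.pi * R) := by
  rw [lintegral_ball_polar (by fun_prop)]
  have h : ∀ r ∈ Ioo 0 R, ENNReal.ofReal r * ∫⁻ θ in Ioo (-Real.pi) Real.pi,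
      ENNReal.ofReal (1 / ‖a - circleMap a r θ‖) = ENNReal.ofReal (2 * Real.pi) := by
    rintro r ⟨hr, -⟩
    have : ∀ θ, ‖a - circleMap a r θ‖ = r := fun θ => by
      rw [norm_sub_rev]; simp [circleMap, abs_of_pos hr]
    simp_rw [this]
    rw [setLIntegral_const, Real.volume_Ioo, ← mul_assoc, ← ENNReal.ofReal_mul hr.le,
      mul_one_div_cancel hr.ne', ENNReal.ofReal_one, one_mul]
    congr 1; ring
  rw [setLIntegral_congr_fun measurableSet_Ioo h, setLIntegral_const, Real.volume_Ioo, sub_zero,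
    ← ENNReal.ofReal_mul (by positivity)]

lemma pk_le {ξ z : ℂ} (hξ : ‖ξ‖ = 1) (hz : ‖z‖ < 1) :
    pk ξ z ≤ 2 * ENNReal.ofReal (1 / ‖ξ - z‖) := by
  have h1 : 1 - ‖z‖ ≤ ‖ξ - z‖ := by rw [← hξ]; exact norm_sub_norm_le _ _
  have h0 : 0 < ‖ξ - z‖ := by linarith
  rw [pk, ← ENNReal.ofReal_ofNat 2, ← ENNReal.ofReal_mul (by norm_num)]
  apply ENNReal.ofReal_le_ofReal
  rw [mul_one_div, div_le_div_iff₀ (by positivity) h0]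
  have : 1 - ‖z‖ ^ 2 ≤ 2 * ‖ξ - z‖ := by nlinarith [norm_nonneg z]
  nlinarith

lemma measurableSet_disc : MeasurableSet disc := measurableSet_ball

lemma mem_disc {z : ℂ} : z ∈ disc ↔ ‖z‖ < 1 := by simp [disc]

lemma lintegral_W_lt_top {μ : Measure ℂ} [IsFiniteMeasure μ] (hμ : OnCircle μ) :
    ∫⁻ z in disc, W μ z < ⊤ := by
  unfold W
  rw [lintegral_lintegral_swap (f := fun z ξ => pk ξ z)
    (measurable_pk.comp measurable_swap).aemeasurable]
  have h : ∀ᵐ ξ ∂μ, ∫⁻ z in disc, pk ξ z ≤ 2 * ENNReal.ofReal (2 * Real.pi * 2) := by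
    filter_upwards [ae_norm_eq_one hμ] with ξ hξ
    rw [← lintegral_ball_inv_norm_sub ξ 2, ← lintegral_const_mul _ (by fun_prop)]
    refine (setLIntegral_mono' measurableSet_disc fun z hz => pk_le hξ (mem_disc.1 hz)).trans ?_
    refine lintegral_mono_set fun z hz => ?_
    rw [mem_disc] at hz
    rw [mem_ball, dist_eq_norm]
    linarith [norm_sub_le z ξ]
  refine (lintegral_mono_ae h).trans_lt ?_
  rw [lintegral_const]
  exact ENNReal.mul_lt_top (ENNReal.mul_lt_top (by simp) ENNReal.ofReal_lt_top) (measure_lt_top _ _)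

lemma enorm_sq_mul_le_lintegral_circle {h : ℂ → ℂ} {a : ℂ} {r : ℝ} (hr : 0 < r)
    (hh : DifferentiableOn ℂ h (closedBall a r)) :
    ‖h a‖ₑ ^ 2 * ENNReal.ofReal (2 * Real.pi) ≤
      ∫⁻ θ in Ioo (-Real.pi) Real.pi, ‖h (circleMap a r θ)‖ₑ ^ 2 := by
  have hd : DiffContOnCl ℂ (fun z => h z ^ 2) (ball a |r|) := by
    rw [abs_of_pos hr]
    refine DifferentiableOn.diffContOnCl ?_
    rw [closure_ball _ hr.ne']
    exact hh.pow 2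
  have h1 := hd.circleAverage
  rw [Real.circleAverage_eq_integral_add (-Real.pi),
    intervalIntegral.integral_comp_add_right (fun θ => h (circleMap a r θ) ^ 2)] at h1
  rw [show (0 : ℝ) + -Real.pi = -Real.pi by ring,
    show 2 * Real.pi + -Real.pi = Real.pi by ring] at h1
  have hpi : 0 < 2 * Real.pi := by positivity
  have h2 : ∫ θ in (-Real.pi)..Real.pi, h (circleMap a r θ) ^ 2 = (2 * Real.pi) • h a ^ 2 := by
    rw [← h1, smul_inv_smul₀ hpi.ne']
  have h3 : ‖h a‖ₑ ^ 2 * ENNReal.ofReal (2 * Real.pi) =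
      ‖∫ θ in (-Real.pi)..Real.pi, h (circleMap a r θ) ^ 2‖ₑ := by
    rw [h2, enorm_smul, enorm_pow, mul_comm, Real.enorm_eq_ofReal hpi.le]
  rw [h3, intervalIntegral.integral_of_le (by linarith), ← restrict_Ioo_eq_restrict_Ioc]
  refine (enorm_integral_le_lintegral_enorm _).trans (le_of_eq ?_)
  simp_rw [enorm_pow]

lemma enorm_sq_mul_le_lintegral_ball {h : ℂ → ℂ} (hm : Measurable h) {a : ℂ} {ρ : ℝ} (hρ : 0 < ρ)
    (hh : DifferentiableOn ℂ h (ball a ρ)) :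
    ‖h a‖ₑ ^ 2 * ENNReal.ofReal (Real.pi * ρ ^ 2) ≤ ∫⁻ z in ball a ρ, ‖h z‖ₑ ^ 2 := by
  rw [lintegral_ball_polar (by fun_prop)]
  have h1 : ∀ r ∈ Ioo 0 ρ, ENNReal.ofReal r * (‖h a‖ₑ ^ 2 * ENNReal.ofReal (2 * Real.pi)) ≤
      ENNReal.ofReal r * ∫⁻ θ in Ioo (-Real.pi) Real.pi, ‖h (circleMap a r θ)‖ₑ ^ 2 := by
    rintro r ⟨hr, hr'⟩
    gcongr
    exact enorm_sq_mul_le_lintegral_circle hr (hh.mono (closedBall_subset_ball hr'))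
  refine le_trans (le_of_eq ?_) (setLIntegral_mono' measurableSet_Ioo h1)
  rw [lintegral_mul_const _ (by fun_prop), restrict_Ioo_eq_restrict_Ioc,
    ← ofReal_integral_eq_lintegral_ofReal, ← intervalIntegral.integral_of_le hρ.le, integral_id,
    mul_left_comm, ← ENNReal.ofReal_mul]
  · congr 2; ring
  · nlinarith
  · exact (intervalIntegrable_iff_integrableOn_Ioc_of_le hρ.le).1 intervalIntegral.intervalIntegrable_id
  · exact (ae_restrict_mem measurableSet_Ioc).mono fun r hr => hr.1.le

lemma lintegral_pk_le {ξ w : ℂ} (hξ : ‖ξ‖ = 1) {s : ℝ} (hs : 0 < s) (hs1 : s < 1) :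
    ∫⁻ z in {z : ℂ | ‖z‖ < 1 ∧ s < ‖z‖ ∧ ‖(s : ℂ) * z - w‖ < (1 - s) / 2}, pk ξ z ≤
      ENNReal.ofReal (324 * Real.pi * (1 - s) ^ 2) * pk ξ w := by
  set S := {z : ℂ | ‖z‖ < 1 ∧ s < ‖z‖ ∧ ‖(s : ℂ) * z - w‖ < (1 - s) / 2} with hS
  have hS1 : MeasurableSet {z : ℂ | ‖z‖ < 1} :=
    measurableSet_lt measurable_norm measurable_const
  have hS2 : MeasurableSet {z : ℂ | s < ‖z‖} :=
    measurableSet_lt measurable_const measurable_norm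
  have hS3 : MeasurableSet {z : ℂ | ‖(s : ℂ) * z - w‖ < (1 - s) / 2} :=
    measurableSet_lt (by fun_prop) measurable_const
  have hSm : MeasurableSet S := hS1.inter (hS2.inter hS3)
  rcases S.eq_empty_or_nonempty with h0 | ⟨z0, hz0⟩
  · simp [h0]
  set δ := 1 - s with hδ
  have hδ0 : 0 < δ := by linarith
  have hsz : ∀ z : ℂ, ‖(s : ℂ) * z‖ = s * ‖z‖ := fun z => by simp [abs_of_pos hs]
  have hw : ‖w‖ ≤ 1 - δ / 2 := by
    have h1 := norm_sub_norm_le w ((s : ℂ) * z0)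
    rw [norm_sub_rev, hsz] at h1
    nlinarith [hz0.1, hz0.2.2]
  have hw2 : δ / 2 ≤ 1 - ‖w‖ ^ 2 := by nlinarith [norm_nonneg w]
  have hw3 : 0 ≤ 1 - ‖w‖ ^ 2 := by linarith
  have hclose : ∀ z ∈ S, ‖z - w‖ < 3 / 2 * δ := by
    rintro z ⟨h1, -, h3⟩
    have h2 : z - w = (((1 - s : ℝ) : ℂ) * z) + ((s : ℂ) * z - w) := by push_cast; ring
    have h4 : ‖((1 - s : ℝ) : ℂ) * z‖ ≤ δ := by
      rw [norm_mul, Complex.norm_real, Real.norm_of_nonneg hδ0.le]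
      nlinarith [norm_nonneg z]
    rw [h2]
    linarith [norm_add_le (((1 - s : ℝ) : ℂ) * z) ((s : ℂ) * z - w)]
  have hd0 : 0 < ‖ξ - w‖ := by
    have := norm_sub_norm_le ξ w
    rw [hξ] at this; linarith
  by_cases hd : 3 * δ ≤ ‖ξ - w‖
  · have hle : ∀ z ∈ S, pk ξ z ≤ 16 * pk ξ w := by
      intro z hz
      have h1 : ‖ξ - w‖ / 2 ≤ ‖ξ - z‖ := by
        have h2 := norm_add_le (ξ - z) (z - w)
        rw [sub_add_sub_cancel] at h2
        linarith [hclose z hz]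
      rw [pk, pk, ← ENNReal.ofReal_ofNat 16, ← ENNReal.ofReal_mul (by norm_num)]
      apply ENNReal.ofReal_le_ofReal
      have h3 : 1 - ‖z‖ ^ 2 ≤ 4 * (1 - ‖w‖ ^ 2) := by nlinarith [hz.1, hz.2.1, norm_nonneg z]
      have h4 : 0 ≤ 4 * (1 - ‖w‖ ^ 2) := by linarith
      calc (1 - ‖z‖ ^ 2) / ‖ξ - z‖ ^ 2 ≤ (4 * (1 - ‖w‖ ^ 2)) / (‖ξ - w‖ / 2) ^ 2 := by gcongr
        _ = _ := by field_simp; ring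
    calc ∫⁻ z in S, pk ξ z ≤ ∫⁻ z in S, 16 * pk ξ w := setLIntegral_mono' hSm hle
      _ = 16 * pk ξ w * volume S := setLIntegral_const _ _
      _ ≤ 16 * pk ξ w * volume (ball w (3 / 2 * δ)) := by
          gcongr
          exact fun z hz => by rw [mem_ball, dist_eq_norm]; exact hclose z hz
      _ ≤ ENNReal.ofReal (324 * Real.pi * δ ^ 2) * pk ξ w := by
          rw [Complex.volume_ball, mul_comm (16 : ℝ≥0∞), mul_assoc, mul_comm (pk ξ w)]
          gcongr
          rw [← ENNReal.ofReal_ofNat 16, ← ENNReal.ofReal_pow (by positivity),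
            show (NNReal.pi : ℝ≥0∞) = ENNReal.ofReal Real.pi from
              (ENNReal.ofReal_coe_nnreal (p := NNReal.pi)).symm,
            ← ENNReal.ofReal_mul (by positivity), ← ENNReal.ofReal_mul (by norm_num)]
          apply ENNReal.ofReal_le_ofReal
          nlinarith [Real.pi_pos, mul_pos Real.pi_pos (pow_pos hδ0 2)]
  · push Not at hd
    calc ∫⁻ z in S, pk ξ z
        ≤ ∫⁻ z in S, 2 * ENNReal.ofReal (1 / ‖ξ - z‖) :=
          setLIntegral_mono' hSm fun z hz => pk_le hξ hz.1
      _ ≤ ∫⁻ z in ball ξ (9 / 2 * δ), 2 * ENNReal.ofReal (1 / ‖ξ - z‖) := by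
          refine lintegral_mono_set fun z hz => ?_
          rw [mem_ball, dist_eq_norm]
          have h2 := norm_add_le (z - w) (w - ξ)
          rw [sub_add_sub_cancel, norm_sub_rev w ξ] at h2
          linarith [hclose z hz]
      _ = ENNReal.ofReal (18 * Real.pi * δ) := by
          rw [lintegral_const_mul _ (by fun_prop), lintegral_ball_inv_norm_sub,
            ← ENNReal.ofReal_ofNat 2, ← ENNReal.ofReal_mul (by norm_num)]
          congr 1; ring
      _ ≤ ENNReal.ofReal (324 * Real.pi * δ ^ 2) * pk ξ w := by
          rw [pk, ← ENNReal.ofReal_mul (by positivity)]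
          apply ENNReal.ofReal_le_ofReal
          have h3 : (δ / 2) / (3 * δ) ^ 2 ≤ (1 - ‖w‖ ^ 2) / ‖ξ - w‖ ^ 2 := by gcongr
          calc 18 * Real.pi * δ = 324 * Real.pi * δ ^ 2 * ((δ / 2) / (3 * δ) ^ 2) := by
                field_simp; norm_num
            _ ≤ _ := by gcongr

lemma measurable_pk_left (z : ℂ) : Measurable fun ξ => pk ξ z := by
  unfold pk; fun_prop

lemma lintegral_W_le {μ : Measure ℂ} [IsFiniteMeasure μ] (hμ : OnCircle μ) (w : ℂ) {s : ℝ}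
    (hs : 0 < s) (hs1 : s < 1) :
    ∫⁻ z in {z : ℂ | ‖z‖ < 1 ∧ s < ‖z‖ ∧ ‖(s : ℂ) * z - w‖ < (1 - s) / 2}, W μ z ≤
      ENNReal.ofReal (324 * Real.pi * (1 - s) ^ 2) * W μ w := by
  unfold W
  rw [lintegral_lintegral_swap (f := fun z ξ => pk ξ z)
    (measurable_pk.comp measurable_swap).aemeasurable,
    ← lintegral_const_mul _ (measurable_pk_left w)]
  refine lintegral_mono_ae ?_
  filter_upwards [ae_norm_eq_one hμ] with ξ hξ
  exact lintegral_pk_le hξ hs hs1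

lemma W_le_four_mul {μ : Measure ℂ} [IsFiniteMeasure μ] (hμ : OnCircle μ) {z : ℂ} {s : ℝ}
    (hs : 0 < s) (hs1 : s < 1) (hz : ‖z‖ ≤ s) : W μ z ≤ 4 * W μ ((s : ℂ) * z) := by
  unfold W
  rw [← lintegral_const_mul _ (measurable_pk_left _)]
  refine lintegral_mono_ae ?_
  filter_upwards [ae_norm_eq_one hμ] with ξ hξ
  have hsz : ‖(s : ℂ) * z‖ = s * ‖z‖ := by simp [abs_of_pos hs]
  have h1 : 1 - ‖z‖ ≤ ‖ξ - z‖ := by rw [← hξ]; exact norm_sub_norm_le _ _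
  have h2 : ‖ξ - (s : ℂ) * z‖ ≤ 2 * ‖ξ - z‖ := by
    have h3 : ξ - (s : ℂ) * z = (ξ - z) + (((1 - s : ℝ) : ℂ) * z) := by push_cast; ring
    have h4 : ‖((1 - s : ℝ) : ℂ) * z‖ ≤ 1 - ‖z‖ := by
      rw [norm_mul, Complex.norm_real, Real.norm_of_nonneg (by linarith)]
      nlinarith [norm_nonneg z]
    rw [h3]
    linarith [norm_add_le (ξ - z) (((1 - s : ℝ) : ℂ) * z)]
  have h5 : 0 < ‖ξ - (s : ℂ) * z‖ := by
    have := norm_sub_norm_le ξ ((s : ℂ) * z)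
    rw [hξ, hsz] at this
    nlinarith [norm_nonneg z]
  rw [pk, pk, ← ENNReal.ofReal_ofNat 4, ← ENNReal.ofReal_mul (by norm_num)]
  apply ENNReal.ofReal_le_ofReal
  have h6 : 1 - ‖z‖ ^ 2 ≤ 1 - ‖(s : ℂ) * z‖ ^ 2 := by
    have h8 : s * ‖z‖ ≤ ‖z‖ := mul_le_of_le_one_left (norm_nonneg z) hs1.le
    rw [hsz]; gcongr
  have h7 : 0 ≤ 1 - ‖z‖ ^ 2 := by nlinarith [norm_nonneg z]
  calc (1 - ‖z‖ ^ 2) / ‖ξ - z‖ ^ 2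
      ≤ (1 - ‖(s : ℂ) * z‖ ^ 2) / (‖ξ - (s : ℂ) * z‖ / 2) ^ 2 := by
        gcongr
        · linarith
        · linarith
    _ = _ := by field_simp; norm_num

/-- The annulus `{R < |z| < 1}`. -/
def ann (R : ℝ) : Set ℂ := {z | R < ‖z‖ ∧ ‖z‖ < 1}

lemma measurableSet_ann (R : ℝ) : MeasurableSet (ann R) := by
  have h1 : MeasurableSet {z : ℂ | ‖z‖ < 1} := measurableSet_lt measurable_norm measurable_const
  have h2 : MeasurableSet {z : ℂ | R < ‖z‖} := measurableSet_lt measurable_const measurable_norm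
  exact h2.inter h1

lemma ann_subset_disc (R : ℝ) : ann R ⊆ disc := fun _ hz => mem_disc.2 hz.2

lemma lintegral_comp_real_mul (k : ℂ → ℝ≥0∞) {s : ℝ} (hs : 0 < s) :
    ∫⁻ z, k ((s : ℂ) * z) = ENNReal.ofReal ((s ^ 2)⁻¹) * ∫⁻ z, k z := by
  have h := Measure.map_addHaar_smul (volume : Measure ℂ) hs.ne'
  have h2 : MeasurableEmbedding (fun z : ℂ => s • z) :=
    (Homeomorph.smulOfNeZero s hs.ne').measurableEmbedding
  have h3 : ∫⁻ z, k (s • z) = ∫⁻ z, k z ∂(Measure.map (fun z : ℂ => s • z) volume) :=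
    (h2.lintegral_map k).symm
  simp_rw [Complex.real_smul] at h3 h
  rw [h3]
  rw [show (fun z : ℂ => (s : ℂ) * z) = (fun z : ℂ => s • z) by ext; simp]
  rw [Measure.map_addHaar_smul (volume : Measure ℂ) hs.ne', lintegral_smul_measure,
    Complex.finrank_real_complex, abs_of_pos (by positivity), smul_eq_mul]

lemma lintegral_dilation_inner {μ : Measure ℂ} [IsFiniteMeasure μ] (hμ : OnCircle μ) {h : ℂ → ℂ}
    {s R : ℝ} (hs : 1 / 2 ≤ s) (hs1 : s < 1) :
    ∫⁻ z in {z : ℂ | R < ‖z‖ ∧ ‖z‖ ≤ s}, ‖h ((s : ℂ) * z)‖ₑ ^ 2 * W μ z ≤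
      16 * ∫⁻ w in ann (2 * R - 1), ‖h w‖ₑ ^ 2 * W μ w := by
  have hs0 : 0 < s := by linarith
  set k : ℂ → ℝ≥0∞ := (ann (2 * R - 1)).indicator fun w => ‖h w‖ₑ ^ 2 * W μ w with hk
  have h1 : ∀ z ∈ {z : ℂ | R < ‖z‖ ∧ ‖z‖ ≤ s},
      ‖h ((s : ℂ) * z)‖ₑ ^ 2 * W μ z ≤ 4 * k ((s : ℂ) * z) := by
    rintro z ⟨hz1, hz2⟩
    have hsz : ‖(s : ℂ) * z‖ = s * ‖z‖ := by simp [abs_of_pos hs0]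
    have hmem : (s : ℂ) * z ∈ ann (2 * R - 1) := by
      refine ⟨?_, ?_⟩ <;> rw [hsz] <;> nlinarith [norm_nonneg z]
    rw [hk, indicator_of_mem hmem, mul_left_comm]
    gcongr
    exact W_le_four_mul hμ hs0 hs1 hz2
  have hm1 : MeasurableSet {z : ℂ | ‖z‖ ≤ s} := measurableSet_le measurable_norm measurable_const
  have hm2 : MeasurableSet {z : ℂ | R < ‖z‖} := measurableSet_lt measurable_const measurable_norm
  calc _ ≤ ∫⁻ z in {z : ℂ | R < ‖z‖ ∧ ‖z‖ ≤ s}, 4 * k ((s : ℂ) * z) :=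
        setLIntegral_mono' (hm2.inter hm1) h1
    _ ≤ ∫⁻ z, 4 * k ((s : ℂ) * z) := setLIntegral_le_lintegral _ _
    _ = 4 * (ENNReal.ofReal ((s ^ 2)⁻¹) * ∫⁻ z, k z) := by
        rw [lintegral_const_mul' _ _ (by simp), lintegral_comp_real_mul k hs0]
    _ ≤ 4 * (4 * ∫⁻ z, k z) := by
        gcongr
        rw [← ENNReal.ofReal_ofNat 4]
        apply ENNReal.ofReal_le_ofReal
        rw [inv_le_comm₀ (by positivity) (by norm_num)]
        nlinarith
    _ = _ := by
        rw [hk, lintegral_indicator (measurableSet_ann _), ← mul_assoc]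
        norm_num

lemma lintegral_dilation_outer {μ : Measure ℂ} [IsFiniteMeasure μ] (hμ : OnCircle μ) {h : ℂ → ℂ}
    (hm : Measurable h) (hh : DifferentiableOn ℂ h disc)
    {s R : ℝ} (hs : 1 / 2 ≤ s) (hs1 : s < 1) (hR : 3 * (1 - s) ≤ 2 * (1 - R)) :
    ∫⁻ z in {z : ℂ | R < ‖z‖ ∧ s < ‖z‖ ∧ ‖z‖ < 1}, ‖h ((s : ℂ) * z)‖ₑ ^ 2 * W μ z ≤
      1296 * ∫⁻ w in ann (2 * R - 1), ‖h w‖ₑ ^ 2 * W μ w := by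
  have hs0 : 0 < s := by linarith
  set δ := 1 - s with hδ
  have hδ0 : 0 < δ := by linarith
  set S := {z : ℂ | R < ‖z‖ ∧ s < ‖z‖ ∧ ‖z‖ < 1} with hS
  have hm1 : MeasurableSet {z : ℂ | s < ‖z‖} := measurableSet_lt measurable_const measurable_norm
  have hm2 : MeasurableSet {z : ℂ | R < ‖z‖} := measurableSet_lt measurable_const measurable_norm
  have hm3 : MeasurableSet {z : ℂ | ‖z‖ < 1} := measurableSet_lt measurable_norm measurable_const
  have hSm : MeasurableSet S := hm2.inter (hm1.inter hm3)
  have hW := measurable_W μ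
  set c : ℝ≥0∞ := ENNReal.ofReal (4 / (Real.pi * δ ^ 2)) with hc
  set T : Set (ℂ × ℂ) := {p | ‖(s : ℂ) * p.1 - p.2‖ < δ / 2} with hT
  have hTm : MeasurableSet T := measurableSet_lt (by fun_prop) measurable_const
  set k : ℂ → ℂ → ℝ≥0∞ := fun z w => T.indicator (fun p => ‖h p.2‖ₑ ^ 2 * W μ p.1) (z, w) with hk
  have hkm : Measurable (Function.uncurry k) := by
    have : Measurable fun p : ℂ × ℂ => ‖h p.2‖ₑ ^ 2 * W μ p.1 := by fun_prop
    exact this.indicator hTm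
  have h1 : ∀ z ∈ S, ‖h ((s : ℂ) * z)‖ₑ ^ 2 * W μ z ≤
      c * ∫⁻ w in ann (2 * R - 1), k z w := by
    rintro z ⟨hz1, hz2, hz3⟩
    have hsz : ‖(s : ℂ) * z‖ = s * ‖z‖ := by simp [abs_of_pos hs0]
    have hsub : ball ((s : ℂ) * z) (δ / 2) ⊆ ann (2 * R - 1) := by
      intro w hw
      rw [mem_ball, dist_eq_norm] at hw
      have e1 := norm_sub_norm_le w ((s : ℂ) * z)
      have e2 := norm_sub_norm_le ((s : ℂ) * z) w
      rw [norm_sub_rev ((s : ℂ) * z)] at e2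
      rw [hsz] at e1 e2
      constructor <;> nlinarith
    have e3 := enorm_sq_mul_le_lintegral_ball hm (by positivity : 0 < δ / 2)
      (hh.mono (hsub.trans (ann_subset_disc _)))
    have e4 : c * ENNReal.ofReal (Real.pi * (δ / 2) ^ 2) = 1 := by
      rw [hc, ← ENNReal.ofReal_mul (by positivity)]
      rw [ENNReal.ofReal_eq_one]
      field_simp
      norm_num
    calc ‖h ((s : ℂ) * z)‖ₑ ^ 2 * W μ z
        = c * (‖h ((s : ℂ) * z)‖ₑ ^ 2 * ENNReal.ofReal (Real.pi * (δ / 2) ^ 2)) * W μ z := by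
          rw [mul_left_comm, e4, mul_one]
      _ ≤ c * (∫⁻ w in ball ((s : ℂ) * z) (δ / 2), ‖h w‖ₑ ^ 2) * W μ z := by gcongr
      _ = c * ∫⁻ w in ball ((s : ℂ) * z) (δ / 2), ‖h w‖ₑ ^ 2 * W μ z := by
          rw [lintegral_mul_const _ (by fun_prop), mul_assoc]
      _ = c * ∫⁻ w in ball ((s : ℂ) * z) (δ / 2), k z w := by
          congr 1
          refine setLIntegral_congr_fun measurableSet_ball fun w hw => ?_
          have : (z, w) ∈ T := by
            rw [mem_ball, dist_eq_norm, norm_sub_rev] at hw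
            exact hw
          simp only [hk, indicator_of_mem this]
      _ ≤ _ := by gcongr
  calc _ ≤ ∫⁻ z in S, c * ∫⁻ w in ann (2 * R - 1), k z w := setLIntegral_mono' hSm h1
    _ = c * ∫⁻ w in ann (2 * R - 1), ∫⁻ z in S, k z w := by
        rw [lintegral_const_mul' _ _ (by simp [hc]),
          lintegral_lintegral_swap (f := k) hkm.aemeasurable]
    _ ≤ c * ∫⁻ w in ann (2 * R - 1), ENNReal.ofReal (324 * Real.pi * δ ^ 2) *
          (‖h w‖ₑ ^ 2 * W μ w) := by
        gcongr with w
        set T' := {z : ℂ | ‖z‖ < 1 ∧ s < ‖z‖ ∧ ‖(s : ℂ) * z - w‖ < δ / 2} with hT'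
        have hm4 : MeasurableSet {z : ℂ | ‖(s : ℂ) * z - w‖ < δ / 2} :=
          measurableSet_lt (by fun_prop) measurable_const
        have hT'm : MeasurableSet T' := hm3.inter (hm1.inter hm4)
        calc ∫⁻ z in S, k z w
            ≤ ∫⁻ z in S, T'.indicator (fun z => ‖h w‖ₑ ^ 2 * W μ z) z := by
              refine setLIntegral_mono' hSm fun z hz => ?_
              by_cases hz' : (z, w) ∈ T
              · have : z ∈ T' := ⟨hz.2.2, hz.2.1, hz'⟩
                simp only [hk, indicator_of_mem hz', indicator_of_mem this, le_refl]
              · simp only [hk, indicator_of_notMem hz', zero_le]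
          _ ≤ ∫⁻ z, T'.indicator (fun z => ‖h w‖ₑ ^ 2 * W μ z) z := setLIntegral_le_lintegral _ _
          _ = ‖h w‖ₑ ^ 2 * ∫⁻ z in T', W μ z := by
              rw [lintegral_indicator hT'm, lintegral_const_mul _ hW]
          _ ≤ ‖h w‖ₑ ^ 2 * (ENNReal.ofReal (324 * Real.pi * δ ^ 2) * W μ w) := by
              gcongr
              exact lintegral_W_le hμ w hs0 hs1
          _ = _ := by ring
    _ = _ := by
        rw [lintegral_const_mul' _ _ (by simp), ← mul_assoc, hc,
          ← ENNReal.ofReal_mul (by positivity)]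
        congr 1
        rw [← ENNReal.ofReal_ofNat 1296]
        congr 1
        field_simp
        norm_num

lemma lintegral_dilation_le {μ : Measure ℂ} [IsFiniteMeasure μ] (hμ : OnCircle μ) {h : ℂ → ℂ}
    (hm : Measurable h) (hh : DifferentiableOn ℂ h disc)
    {s R : ℝ} (hs : 1 / 2 ≤ s) (hs1 : s < 1) (hR : 3 * (1 - s) ≤ 2 * (1 - R)) :
    ∫⁻ z in ann R, ‖h ((s : ℂ) * z)‖ₑ ^ 2 * W μ z ≤
      1312 * ∫⁻ w in ann (2 * R - 1), ‖h w‖ₑ ^ 2 * W μ w := by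
  have hsub : ann R ⊆ {z : ℂ | R < ‖z‖ ∧ ‖z‖ ≤ s} ∪ {z : ℂ | R < ‖z‖ ∧ s < ‖z‖ ∧ ‖z‖ < 1} := by
    rintro z ⟨h1, h2⟩
    rcases le_or_gt ‖z‖ s with h3 | h3
    · exact Or.inl ⟨h1, h3⟩
    · exact Or.inr ⟨h1, h3, h2⟩
  calc _ ≤ _ := lintegral_mono_set hsub
    _ ≤ _ := lintegral_union_le _ _ _
    _ ≤ _ := add_le_add (lintegral_dilation_inner hμ hs hs1)
      (lintegral_dilation_outer hμ hm hh hs hs1 hR)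
    _ = _ := by rw [← add_mul]; norm_num

lemma circleAverage_eq (f : ℂ → ℝ) (r : ℝ) :
    Real.circleAverage f 0 r =
      (1 / (2 * Real.pi)) * ∫ t in (0 : ℝ)..(2 * Real.pi), f ((r : ℂ) * bpt t) := by
  rw [Real.circleAverage_def, smul_eq_mul, one_div]
  simp_rw [circleMap_zero, bpt, mul_comm Complex.I]

lemma mem_hardySet {f : ℂ → ℂ} {x : ℝ} :
    x ∈ hardySet f ↔
      ∃ r : ℝ, 0 < r ∧ r < 1 ∧ x = Real.circleAverage (fun z => ‖f z‖ ^ 2) 0 r := by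
  simp only [hardySet, mem_ofPred_eq, circleAverage_eq]

/-- `F` is holomorphic with both Hardy norm and Dirichlet energy at most `ε`. -/
structure Small (μ : Measure ℂ) (ε : ℝ) (F : ℂ → ℂ) : Prop where
  diff : DifferentiableOn ℂ F disc
  mean : ∀ r, 0 < r → r < 1 → Real.circleAverage (fun z => ‖F z‖ ^ 2) 0 r ≤ ε
  energy : ∫⁻ z in disc, ‖deriv F z‖ₑ ^ 2 * W μ z ≤ ENNReal.ofReal ε

lemma sphere_subset_disc {r : ℝ} (hr : 0 < r) (hr1 : r < 1) : sphere (0 : ℂ) |r| ⊆ disc := by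
  intro z hz
  rw [abs_of_pos hr, mem_sphere_zero_iff_norm] at hz
  exact mem_disc.2 (hz ▸ hr1)

lemma circleIntegrable_norm_sq {F : ℂ → ℂ} (hF : DifferentiableOn ℂ F disc) {r : ℝ} (hr : 0 < r)
    (hr1 : r < 1) : CircleIntegrable (fun z => ‖F z‖ ^ 2) 0 r :=
  ContinuousOn.circleIntegrable' (((hF.continuousOn.mono (sphere_subset_disc hr hr1)).norm).pow 2)

lemma enorm_add_sq_le (a b : ℂ) : ‖a + b‖ₑ ^ 2 ≤ 2 * ‖a‖ₑ ^ 2 + 2 * ‖b‖ₑ ^ 2 := by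
  simp only [← ofReal_norm]
  rw [← ENNReal.ofReal_pow (by positivity), ← ENNReal.ofReal_pow (by positivity),
    ← ENNReal.ofReal_pow (by positivity), ← ENNReal.ofReal_ofNat 2,
    ← ENNReal.ofReal_mul (by positivity), ← ENNReal.ofReal_mul (by positivity),
    ← ENNReal.ofReal_add (by positivity) (by positivity)]
  apply ENNReal.ofReal_le_ofReal
  nlinarith [norm_add_le a b, norm_nonneg (a + b), sq_nonneg (‖a‖ - ‖b‖)]

lemma Small.eps_nonneg {μ : Measure ℂ} {ε : ℝ} {F : ℂ → ℂ} (hF : Small μ ε F) : 0 ≤ ε := by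
  refine le_trans ?_ (hF.mean (1 / 2) (by norm_num) (by norm_num))
  rw [circleAverage_eq]
  refine mul_nonneg (by positivity) (intervalIntegral.integral_nonneg (by positivity) fun t _ => ?_)
  positivity

lemma differentiableAt_of_disc {F : ℂ → ℂ} (hF : DifferentiableOn ℂ F disc) {z : ℂ}
    (hz : z ∈ disc) : DifferentiableAt ℂ F z :=
  hF.differentiableAt (isOpen_ball.mem_nhds hz)

lemma Small.add {μ : Measure ℂ} [SFinite μ] {ε δ : ℝ} {F G : ℂ → ℂ} (hF : Small μ ε F)
    (hG : Small μ δ G) : Small μ (2 * ε + 2 * δ) (fun z => F z + G z) where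
  diff := hF.diff.add hG.diff
  mean r hr hr1 := by
    have i1 := circleIntegrable_norm_sq hF.diff hr hr1
    have i2 := circleIntegrable_norm_sq hG.diff hr hr1
    have i3 := circleIntegrable_norm_sq (hF.diff.add hG.diff) hr hr1
    have i4 : CircleIntegrable (fun z => (2 : ℝ) • ‖F z‖ ^ 2) 0 r := i1.const_smul
    have i5 : CircleIntegrable (fun z => (2 : ℝ) • ‖G z‖ ^ 2) 0 r := i2.const_smul
    have e1 := hF.mean r hr hr1
    have e2 := hG.mean r hr hr1
    calc _ ≤ Real.circleAverage (fun z => (2 : ℝ) • ‖F z‖ ^ 2 + (2 : ℝ) • ‖G z‖ ^ 2) 0 r := by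
          refine Real.circleAverage_mono i3 (i4.add i5) fun z _ => ?_
          simp only [smul_eq_mul]
          nlinarith [norm_add_le (F z) (G z), norm_nonneg (F z + G z),
            sq_nonneg (‖F z‖ - ‖G z‖)]
      _ = 2 * Real.circleAverage (fun z => ‖F z‖ ^ 2) 0 r +
            2 * Real.circleAverage (fun z => ‖G z‖ ^ 2) 0 r := by
          rw [Real.circleAverage_fun_add i4 i5,
            Real.circleAverage_fun_smul, Real.circleAverage_fun_smul, smul_eq_mul, smul_eq_mul]
      _ ≤ _ := by linarith
  energy := by
    have hW := measurable_W μ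
    have m1 := measurable_deriv F
    have m2 := measurable_deriv G
    calc _ ≤ ∫⁻ z in disc, (2 * (‖deriv F z‖ₑ ^ 2 * W μ z) + 2 * (‖deriv G z‖ₑ ^ 2 * W μ z)) := by
          refine setLIntegral_mono' measurableSet_disc fun z hz => ?_
          rw [deriv_fun_add (differentiableAt_of_disc hF.diff hz)
            (differentiableAt_of_disc hG.diff hz), ← mul_assoc, ← mul_assoc, ← add_mul]
          gcongr
          exact enorm_add_sq_le _ _
      _ ≤ _ := by
          rw [lintegral_add_left (by fun_prop), lintegral_const_mul _ (by fun_prop),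
            lintegral_const_mul _ (by fun_prop),
            ENNReal.ofReal_add (by linarith [hF.eps_nonneg]) (by linarith [hG.eps_nonneg]),
            ENNReal.ofReal_mul (by norm_num), ENNReal.ofReal_mul (by norm_num),
            ENNReal.ofReal_ofNat]
          gcongr
          exacts [hF.energy, hG.energy]

lemma enorm_dirichletDensity {μ : Measure ℂ} [IsFiniteMeasure μ] (hμ : OnCircle μ) (F : ℂ → ℂ)
    {z : ℂ} (hz : z ∈ disc) : ‖dirichletDensity μ F z‖ₑ = ‖deriv F z‖ₑ ^ 2 * W μ z := by
  rw [dirichletDensity, enorm_mul, enorm_pow, enorm_norm, ← ofReal_poissonMu hμ (mem_disc.1 hz),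
    Real.enorm_eq_ofReal (poissonMu_nonneg μ (mem_disc.1 hz))]

lemma MemD.energy_lt_top {μ : Measure ℂ} [IsFiniteMeasure μ] (hμ : OnCircle μ) {F : ℂ → ℂ}
    (hF : MemD μ F) : ∫⁻ z in disc, ‖deriv F z‖ₑ ^ 2 * W μ z < ⊤ := by
  rw [← setLIntegral_congr_fun measurableSet_disc fun z hz => enorm_dirichletDensity hμ F hz]
  exact hF.2.2

lemma Small.dNormSq_le {μ : Measure ℂ} [IsFiniteMeasure μ] (hμ : OnCircle μ) {ε : ℝ} {F : ℂ → ℂ}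
    (hF : Small μ ε F) : dNormSq μ F ≤ 2 * ε := by
  have h1 : hardyNormSq F ≤ ε := by
    refine csSup_le ⟨_, 1 / 2, by norm_num, by norm_num, rfl⟩ fun x hx => ?_
    obtain ⟨r, hr, hr1, rfl⟩ := mem_hardySet.1 hx
    exact hF.mean r hr hr1
  have h2 : ∫ z in disc, dirichletDensity μ F z ≤ ε := by
    refine (le_abs_self _).trans ?_
    rw [← Real.norm_eq_abs, ← toReal_enorm]
    refine ENNReal.toReal_le_of_le_ofReal hF.eps_nonneg ?_
    refine (enorm_integral_le_lintegral_enorm _).trans (le_trans (le_of_eq ?_) hF.energy)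
    exact setLIntegral_congr_fun measurableSet_disc fun z hz => enorm_dirichletDensity hμ F hz
  have h3 : dirichletIntegral μ F ≤ ε := by
    unfold dirichletIntegral
    have : 1 / Real.pi ≤ 1 := by
      rw [div_le_one Real.pi_pos]; linarith [Real.pi_gt_three]
    calc _ ≤ 1 / Real.pi * ε := by gcongr
      _ ≤ 1 * ε := by gcongr; exact hF.eps_nonneg
      _ = ε := one_mul _
  unfold dNormSq
  linarith

lemma ball_sub_ann_union (R : ℝ) : disc ⊆ closedBall (0 : ℂ) R ∪ ann R := by
  intro z hz
  rcases le_or_gt ‖z‖ R with h | h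
  · exact Or.inl (mem_closedBall_zero_iff.2 h)
  · exact Or.inr ⟨h, mem_disc.1 hz⟩

lemma tendsto_lintegral_ann {k : ℂ → ℝ≥0∞} (hk : Measurable k) (hfin : ∫⁻ z in disc, k z < ⊤) :
    Tendsto (fun R : ℝ => ∫⁻ z in ann R, k z) (𝓝[<] 1) (𝓝 0) := by
  have h1 : ∀ R, ∫⁻ z in ann R, k z = ∫⁻ z in disc, (ann R).indicator k z := fun R => by
    rw [setLIntegral_indicator (measurableSet_ann R), inter_eq_left.2 (ann_subset_disc R)]
  simp_rw [h1]
  rw [← lintegral_zero (μ := volume.restrict disc)]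
  refine tendsto_lintegral_filter_of_dominated_convergence k
    (Eventually.of_forall fun R => hk.indicator (measurableSet_ann R))
    (Eventually.of_forall fun R => Eventually.of_forall fun z => indicator_le_self _ _ _) hfin.ne ?_
  filter_upwards [ae_restrict_mem measurableSet_disc] with z hz
  refine tendsto_const_nhds.congr' ?_
  have : ∀ᶠ R : ℝ in 𝓝[<] 1, ‖z‖ < R :=
    (eventually_gt_nhds (mem_disc.1 hz)).filter_mono nhdsWithin_le_nhds
  filter_upwards [this] with R hR
  rw [indicator_of_notMem fun h => lt_asymm hR h.1]

lemma tendsto_lintegral_dilation_closedBall {μ : Measure ℂ} [IsFiniteMeasure μ] (hμ : OnCircle μ)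
    {h : ℂ → ℂ} (hm : Measurable h) (hh : ContinuousOn h disc) {R : ℝ} (hR : R < 1) :
    Tendsto (fun s : ℝ => ∫⁻ z in closedBall (0 : ℂ) R, ‖h z - s * h (s * z)‖ₑ ^ 2 * W μ z)
      (𝓝[<] 1) (𝓝 0) := by
  have hsub : closedBall (0 : ℂ) R ⊆ disc := closedBall_subset_ball hR
  have hW := measurable_W μ
  obtain ⟨M, hM⟩ := (isCompact_closedBall (0 : ℂ) R).exists_bound_of_continuousOn (hh.mono hsub)
  have hs : ∀ᶠ s : ℝ in 𝓝[<] 1, 0 < s ∧ s < 1 :=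
    ((eventually_gt_nhds (by norm_num)).filter_mono nhdsWithin_le_nhds).and self_mem_nhdsWithin
  rw [← lintegral_zero (μ := volume.restrict (closedBall (0 : ℂ) R))]
  refine tendsto_lintegral_filter_of_dominated_convergence
    (fun z => ENNReal.ofReal (2 * M) ^ 2 * W μ z)
    (Eventually.of_forall fun R => by fun_prop) ?_ ?_ ?_
  · filter_upwards [hs] with s hs
    filter_upwards [ae_restrict_mem measurableSet_closedBall] with z hz
    gcongr
    rw [← ofReal_norm]
    apply ENNReal.ofReal_le_ofReal
    have hz' : (s : ℂ) * z ∈ closedBall (0 : ℂ) R := by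
      rw [mem_closedBall_zero_iff] at hz ⊢
      rw [norm_mul, Complex.norm_real, Real.norm_of_nonneg hs.1.le]
      nlinarith [norm_nonneg z]
    have e1 := hM z hz
    have e2 := hM _ hz'
    calc ‖h z - s * h (s * z)‖ ≤ ‖h z‖ + ‖(s : ℂ) * h (s * z)‖ := norm_sub_le _ _
      _ = ‖h z‖ + s * ‖h (s * z)‖ := by
        rw [norm_mul, Complex.norm_real, Real.norm_of_nonneg hs.1.le]
      _ ≤ _ := by nlinarith [norm_nonneg (h (s * z))]
  · rw [lintegral_const_mul _ hW]
    refine (ENNReal.mul_lt_top (ENNReal.pow_lt_top ENNReal.ofReal_lt_top) ?_).ne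
    exact (lintegral_mono_set hsub).trans_lt (lintegral_W_lt_top hμ)
  · filter_upwards [ae_restrict_mem measurableSet_closedBall,
      ae_restrict_of_ae_restrict_of_subset hsub
        (ae_lt_top' hW.aemeasurable (lintegral_W_lt_top hμ).ne)] with z hz hWz
    have hc : ContinuousAt h z := hh.continuousAt (isOpen_ball.mem_nhds (hsub hz))
    have t1 : Tendsto (fun s : ℝ => (s : ℂ)) (𝓝[<] 1) (𝓝 1) := by
      have : Tendsto (fun s : ℝ => (s : ℂ)) (𝓝 1) (𝓝 ((1 : ℝ) : ℂ)) :=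
        Complex.continuous_ofReal.tendsto 1
      rw [Complex.ofReal_one] at this
      exact this.mono_left nhdsWithin_le_nhds
    have t2 : Tendsto (fun s : ℝ => (s : ℂ) * z) (𝓝[<] 1) (𝓝 z) := by
      simpa using t1.mul_const z
    have t3 : Tendsto (fun s : ℝ => h z - s * h (s * z)) (𝓝[<] 1) (𝓝 0) := by
      simpa using (tendsto_const_nhds (x := h z)).sub (t1.mul (hc.tendsto.comp t2))
    have t4 : Tendsto (fun s : ℝ => ‖h z - s * h (s * z)‖ₑ ^ 2) (𝓝[<] 1) (𝓝 0) := by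
      have := ((ENNReal.continuous_pow 2).tendsto _).comp t3.enorm
      simpa [Function.comp_def] using this
    simpa using ENNReal.Tendsto.mul_const t4 (Or.inr hWz.ne)

lemma eventually_energy_dilation_le {μ : Measure ℂ} [IsFiniteMeasure μ] (hμ : OnCircle μ)
    {h : ℂ → ℂ} (hm : Measurable h) (hh : DifferentiableOn ℂ h disc)
    (hfin : ∫⁻ z in disc, ‖h z‖ₑ ^ 2 * W μ z < ⊤) {ε : ℝ≥0∞} (hε : 0 < ε) :
    ∀ᶠ s : ℝ in 𝓝[<] 1, ∫⁻ z in disc, ‖h z - s * h (s * z)‖ₑ ^ 2 * W μ z ≤ ε := by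
  have hW := measurable_W μ
  have hε' : 0 < ε / 2 / 2626 := ENNReal.div_pos (ENNReal.half_pos hε.ne').ne' (by simp)
  have hs0 : ∀ᶠ s : ℝ in 𝓝[<] 1, 0 < s ∧ s < 1 :=
    ((eventually_gt_nhds (by norm_num)).filter_mono nhdsWithin_le_nhds).and self_mem_nhdsWithin
  obtain ⟨R', hR'1, hR'0, hR'⟩ := (((tendsto_lintegral_ann (by fun_prop) hfin).eventually
    (Iic_mem_nhds hε')).and hs0).exists
  set R := (1 + R') / 2 with hR
  have hR1 : R < 1 := by linarith
  have hRR : 2 * R - 1 = R' := by rw [hR]; ring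
  have hs2 : ∀ᶠ s : ℝ in 𝓝[<] 1, max (1 / 2) (1 - 2 / 3 * (1 - R)) < s :=
    (eventually_gt_nhds (by rw [max_lt_iff]; constructor <;> linarith)).filter_mono
      nhdsWithin_le_nhds
  filter_upwards [(tendsto_lintegral_dilation_closedBall hμ hm hh.continuousOn hR1).eventually
    (Iic_mem_nhds (ENNReal.half_pos hε.ne')), hs0, hs2] with s h1 h2 h3
  rw [max_lt_iff] at h3
  have h4 := lintegral_dilation_le hμ hm hh (R := R) h3.1.le h2.2 (by linarith)
  rw [hRR] at h4
  have h5 : ∫⁻ z in ann R, ‖h z‖ₑ ^ 2 * W μ z ≤ ε / 2 / 2626 :=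
    (lintegral_mono_set (fun z hz => ⟨by linarith [hz.1], hz.2⟩ : ann R ⊆ ann R')).trans hR'1
  have h6 : ∫⁻ z in ann R, ‖h z - s * h (s * z)‖ₑ ^ 2 * W μ z ≤ ε / 2 := by
    calc _ ≤ ∫⁻ z in ann R, (2 * (‖h z‖ₑ ^ 2 * W μ z) + 2 * (‖h (s * z)‖ₑ ^ 2 * W μ z)) := by
          refine setLIntegral_mono' (measurableSet_ann R) fun z hz => ?_
          rw [← mul_assoc, ← mul_assoc, ← add_mul]
          gcongr
          rw [sub_eq_add_neg]
          refine (enorm_add_sq_le _ _).trans ?_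
          gcongr
          rw [enorm_neg, enorm_mul]
          refine mul_le_of_le_one_left zero_le ?_
          rw [← ofReal_norm, Complex.norm_real, Real.norm_of_nonneg h2.1.le]
          exact ENNReal.ofReal_le_one.2 h2.2.le
      _ = 2 * (∫⁻ z in ann R, ‖h z‖ₑ ^ 2 * W μ z) +
            2 * ∫⁻ z in ann R, ‖h (s * z)‖ₑ ^ 2 * W μ z := by
          rw [lintegral_add_left (by fun_prop), lintegral_const_mul _ (by fun_prop),
            lintegral_const_mul _ (by fun_prop)]
      _ ≤ 2 * (ε / 2 / 2626) + 2 * (1312 * (ε / 2 / 2626)) := by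
          gcongr
          exact h4.trans (by gcongr)
      _ = 2626 * (ε / 2 / 2626) := by ring
      _ = ε / 2 := ENNReal.mul_div_cancel (by simp) (by simp)
  calc _ ≤ _ := lintegral_mono_set (ball_sub_ann_union R)
    _ ≤ _ := lintegral_union_le _ _ _
    _ ≤ ε / 2 + ε / 2 := add_le_add h1 h6
    _ = ε := ENNReal.add_halves ε

lemma circleAverage_norm_sq_sum (a : ℕ → ℂ) {r : ℝ} (hr : 0 < r) (N : ℕ) :
    Real.circleAverage (fun z => ‖∑ j ∈ Finset.range N, a j * z ^ j‖ ^ 2) 0 r =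
      ∑ j ∈ Finset.range N, ‖a j‖ ^ 2 * r ^ (2 * j) := by
  induction N with
  | zero => simp [Real.circleAverage_const]
  | succ N ih =>
    set Q : ℂ → ℂ := fun z => ∑ j ∈ Finset.range N,
      a N * (starRingEnd ℂ) (a j) * (r : ℂ) ^ (2 * j) * z ^ (N - j) with hQ
    have hQd : Differentiable ℂ Q := by
      refine Differentiable.fun_sum fun j _ => ?_
      fun_prop
    have hQ0 : Q 0 = 0 := by
      refine Finset.sum_eq_zero fun j hj => ?_
      rw [Finset.mem_range] at hj
      rw [zero_pow (by omega), mul_zero]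
    have hQa : Real.circleAverage Q 0 r = 0 := by
      exact hQd.diffContOnCl.circleAverage.trans hQ0
    have hQi : CircleIntegrable Q 0 r := hQd.continuous.continuousOn.circleIntegrable'
    have hQre : Real.circleAverage (fun z => (Q z).re) 0 r = 0 := by
      have := Complex.reCLM.circleAverage_comp_comm hQi
      rw [hQa, map_zero] at this
      simpa [Function.comp_def] using this
    have hpt : ∀ z ∈ sphere (0 : ℂ) |r|, ‖∑ j ∈ Finset.range (N + 1), a j * z ^ j‖ ^ 2 =
        ‖∑ j ∈ Finset.range N, a j * z ^ j‖ ^ 2 + (‖a N‖ ^ 2 * r ^ (2 * N) + (2 : ℝ) • (Q z).re) := by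
      intro z hz
      rw [abs_of_pos hr, mem_sphere_zero_iff_norm] at hz
      have hQz : Q z = a N * z ^ N * (starRingEnd ℂ) (∑ j ∈ Finset.range N, a j * z ^ j) := by
        rw [map_sum, Finset.mul_sum]
        refine Finset.sum_congr rfl fun j hj => ?_
        rw [Finset.mem_range] at hj
        have e1 : (r : ℂ) ^ (2 * j) = z ^ j * (starRingEnd ℂ) (z ^ j) := by
          rw [Complex.mul_conj, Complex.normSq_eq_norm_sq, norm_pow, hz]
          push_cast; ring
        have e2 : z ^ N = z ^ (N - j) * z ^ j := by rw [← pow_add]; congr 1; omega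
        rw [e1, e2, map_mul]; ring
      rw [Finset.sum_range_succ, ← Complex.normSq_eq_norm_sq, ← Complex.normSq_eq_norm_sq,
        add_comm, Complex.normSq_add, ← hQz, Complex.normSq_eq_norm_sq, norm_mul, norm_pow, hz,
        smul_eq_mul]
      ring
    have hc : Continuous fun z : ℂ => ‖∑ j ∈ Finset.range N, a j * z ^ j‖ ^ 2 := by fun_prop
    have hQc := hQd.continuous
    rw [Real.circleAverage_congr_sphere hpt, Real.circleAverage_fun_add
      hc.continuousOn.circleIntegrable' (Continuous.continuousOn (by fun_prop)).circleIntegrable',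
      Real.circleAverage_fun_add (circleIntegrable_const _ _ _)
      (Continuous.continuousOn (by fun_prop)).circleIntegrable', Real.circleAverage_const,
      Real.circleAverage_fun_smul, hQre, ih, Finset.sum_range_succ]
    simp

lemma hasSum_circleAverage_norm_sq {a : ℕ → ℂ} {g : ℂ → ℂ}
    (ha : ∀ z ∈ disc, HasSum (fun j => a j * z ^ j) (g z)) {r : ℝ} (hr : 0 < r) (hr1 : r < 1) :
    HasSum (fun j => ‖a j‖ ^ 2 * r ^ (2 * j)) (Real.circleAverage (fun z => ‖g z‖ ^ 2) 0 r) := by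
  rw [hasSum_iff_tendsto_nat_of_nonneg fun j => by positivity]
  simp_rw [← circleAverage_norm_sq_sum a hr, Real.circleAverage_def]
  refine Tendsto.const_smul ?_ _
  have hrd : (r : ℂ) ∈ disc := mem_disc.2 (by rwa [Complex.norm_real, Real.norm_of_nonneg hr.le])
  have hsum : Summable fun j => ‖a j‖ * r ^ j := by
    have := (ha r hrd).summable.norm
    simpa [abs_of_pos hr] using this
  have hz : ∀ t, ‖circleMap 0 r t‖ = r := fun t => by simp [abs_of_pos hr]
  refine intervalIntegral.tendsto_integral_filter_of_dominated_convergence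
    (fun _ => (∑' j, ‖a j‖ * r ^ j) ^ 2) (Eventually.of_forall fun N => ?_)
    (Eventually.of_forall fun N => Eventually.of_forall fun t _ => ?_)
    intervalIntegrable_const (Eventually.of_forall fun t _ => ?_)
  · refine Continuous.aestronglyMeasurable ?_
    have := continuous_circleMap 0 r
    fun_prop
  · rw [Real.norm_of_nonneg (by positivity)]
    gcongr
    refine (norm_sum_le _ _).trans ?_
    simp_rw [norm_mul, norm_pow, hz]
    exact hsum.sum_le_tsum _ fun j _ => by positivity
  · exact ((ha _ (mem_disc.2 (by rwa [hz]))).tendsto_sum_nat.norm).pow 2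

lemma hasSum_taylor {g : ℂ → ℂ} (hg : DifferentiableOn ℂ g disc) :
    ∃ a : ℕ → ℂ, ∀ z ∈ disc, HasSum (fun j => a j * z ^ j) (g z) := by
  refine ⟨fun j => (j.factorial : ℂ)⁻¹ * iteratedDeriv j g 0, fun z hz => ?_⟩
  have := Complex.hasSum_taylorSeries_on_ball (r := 1) hg (z := z) hz
  simpa [smul_eq_mul, mul_comm, mul_left_comm, mul_assoc] using this

lemma eventually_mean_dilation_le {g : ℂ → ℂ} (hg : MemHardy2 g) {ε : ℝ} (hε : 0 < ε) :
    ∀ᶠ s : ℝ in 𝓝[<] 1, ∀ r, 0 < r → r < 1 →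
      Real.circleAverage (fun z => ‖g z - g (s * z)‖ ^ 2) 0 r ≤ ε := by
  obtain ⟨a, ha⟩ := hasSum_taylor hg.1
  obtain ⟨B, hB⟩ := hg.2
  have hs0 : ∀ᶠ s : ℝ in 𝓝[<] 1, 0 < s ∧ s < 1 :=
    ((eventually_gt_nhds (by norm_num)).filter_mono nhdsWithin_le_nhds).and self_mem_nhdsWithin
  have hsum : Summable fun j => ‖a j‖ ^ 2 := by
    refine summable_of_sum_range_le (c := B) (fun j => by positivity) fun N => ?_
    have t1 : Tendsto (fun r : ℝ => ∑ j ∈ Finset.range N, ‖a j‖ ^ 2 * r ^ (2 * j)) (𝓝[<] 1)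
        (𝓝 (∑ j ∈ Finset.range N, ‖a j‖ ^ 2 * 1 ^ (2 * j))) := by
      refine Tendsto.mono_left (Continuous.tendsto ?_ 1) nhdsWithin_le_nhds
      fun_prop
    simp only [one_pow, mul_one] at t1
    refine le_of_tendsto t1 ?_
    filter_upwards [hs0] with r hr
    have h1 := hasSum_circleAverage_norm_sq ha hr.1 hr.2
    exact (sum_le_hasSum _ (fun j _ => by have := hr.1; positivity) h1).trans
      (hB (mem_hardySet.2 ⟨r, hr.1, hr.2, rfl⟩))
  have t2 : Tendsto (fun s : ℝ => ∑' j, ‖a j‖ ^ 2 * (1 - s ^ j) ^ 2) (𝓝[<] 1)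
      (𝓝 (∑' j : ℕ, (0 : ℝ))) := by
    refine tendsto_tsum_of_dominated_convergence hsum (fun j => ?_) ?_
    · have : Tendsto (fun s : ℝ => ‖a j‖ ^ 2 * (1 - s ^ j) ^ 2) (𝓝 1)
          (𝓝 (‖a j‖ ^ 2 * (1 - 1 ^ j) ^ 2)) := Continuous.tendsto (by fun_prop) 1
      simp only [one_pow, sub_self, ne_eq, OfNat.ofNat_ne_zero, not_false_eq_true, zero_pow,
        mul_zero] at this
      exact this.mono_left nhdsWithin_le_nhds
    · filter_upwards [hs0] with s hs j
      rw [Real.norm_of_nonneg (by positivity)]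
      have h1 : s ^ j ≤ 1 := pow_le_one₀ hs.1.le hs.2.le
      have h2 : 0 ≤ s ^ j := pow_nonneg hs.1.le _
      exact mul_le_of_le_one_right (by positivity) (by nlinarith)
  rw [tsum_zero] at t2
  filter_upwards [t2.eventually (Iic_mem_nhds hε), hs0] with s h1 h2 r hr hr1
  refine le_trans ?_ h1
  have hb : ∀ z ∈ disc, HasSum (fun j => (a j * (1 - (s : ℂ) ^ j)) * z ^ j) (g z - g (s * z)) := by
    intro z hz
    have hz' : (s : ℂ) * z ∈ disc := by
      rw [mem_disc] at hz ⊢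
      rw [norm_mul, Complex.norm_real, Real.norm_of_nonneg h2.1.le]
      nlinarith [norm_nonneg z]
    refine ((ha z hz).sub (ha _ hz')).congr_fun fun j => ?_
    rw [mul_pow]; ring
  have h3 := hasSum_circleAverage_norm_sq hb hr hr1
  have h4 : ∀ j, ‖a j * (1 - (s : ℂ) ^ j)‖ ^ 2 = ‖a j‖ ^ 2 * (1 - s ^ j) ^ 2 := fun j => by
    rw [norm_mul, mul_pow, ← Complex.ofReal_pow, ← Complex.ofReal_one, ← Complex.ofReal_sub,
      Complex.norm_real, Real.norm_eq_abs, sq_abs]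
  simp_rw [h4] at h3
  have h5 : Summable fun j => ‖a j‖ ^ 2 * (1 - s ^ j) ^ 2 := by
    refine hsum.of_nonneg_of_le (fun j => by positivity) fun j => ?_
    have h1 : s ^ j ≤ 1 := pow_le_one₀ h2.1.le h2.2.le
    have h2 : 0 ≤ s ^ j := pow_nonneg h2.1.le _
    exact mul_le_of_le_one_right (by positivity) (by nlinarith)
  rw [← h3.tsum_eq]
  refine h3.summable.tsum_le_tsum (fun j => ?_) h5
  exact mul_le_of_le_one_right (by positivity) (pow_le_one₀ hr.le hr1.le)

lemma eventually_small_dilation {μ : Measure ℂ} [IsFiniteMeasure μ] (hμ : OnCircle μ)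
    {g : ℂ → ℂ} (hg : MemD μ g) {ε : ℝ} (hε : 0 < ε) :
    ∀ᶠ s : ℝ in 𝓝[<] 1, Small μ ε (fun z => g z - g (s * z)) := by
  have hd : DifferentiableOn ℂ (deriv g) disc := hg.1.1.deriv isOpen_ball
  have hs0 : ∀ᶠ s : ℝ in 𝓝[<] 1, 0 < s ∧ s < 1 :=
    ((eventually_gt_nhds (by norm_num)).filter_mono nhdsWithin_le_nhds).and self_mem_nhdsWithin
  filter_upwards [eventually_mean_dilation_le hg.1 hε, hs0,
    eventually_energy_dilation_le hμ (measurable_deriv g) hd (hg.energy_lt_top hμ)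
      (ENNReal.ofReal_pos.2 hε)] with s h1 h2 h3
  have hmem : ∀ z ∈ disc, (s : ℂ) * z ∈ disc := fun z hz => by
    rw [mem_disc] at hz ⊢
    rw [norm_mul, Complex.norm_real, Real.norm_of_nonneg h2.1.le]
    nlinarith [norm_nonneg z]
  have hD : ∀ z ∈ disc, HasDerivAt (fun z => g z - g (s * z))
      (deriv g z - s * deriv g (s * z)) z := fun z hz => by
    have e1 := (differentiableAt_of_disc hg.1.1 hz).hasDerivAt
    have e2 := (differentiableAt_of_disc hg.1.1 (hmem z hz)).hasDerivAt
    have e3 : HasDerivAt (fun z : ℂ => (s : ℂ) * z) s z := by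
      simpa using (hasDerivAt_id z).const_mul (s : ℂ)
    have e4 := e2.comp z e3
    rw [mul_comm] at e4
    exact e1.sub e4
  refine ⟨fun z hz => (hD z hz).differentiableAt.differentiableWithinAt, h1, ?_⟩
  refine le_trans (le_of_eq ?_) h3
  exact setLIntegral_congr_fun measurableSet_disc fun z hz => by simp only [(hD z hz).deriv]

lemma exists_small_of_bound {μ : Measure ℂ} [IsFiniteMeasure μ] (hμ : OnCircle μ) {ρ : ℝ}
    (hρ : 1 < ρ) {ε : ℝ} (hε : 0 < ε) :
    ∃ δ > 0, ∀ F : ℂ → ℂ, DifferentiableOn ℂ F (ball 0 ρ) → (∀ z ∈ ball (0 : ℂ) ρ, ‖F z‖ ≤ δ) →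
      Small μ ε F := by
  set c := (ρ - 1) / 2 with hc
  have hc0 : 0 < c := by linarith
  set I := (∫⁻ z in disc, W μ z).toReal with hI
  have hI0 : 0 ≤ I := ENNReal.toReal_nonneg
  have hIe : ∫⁻ z in disc, W μ z = ENNReal.ofReal I :=
    (ENNReal.ofReal_toReal (lintegral_W_lt_top hμ).ne).symm
  set M := 1 + I / c ^ 2 with hM
  have hM0 : 0 < M := by positivity
  refine ⟨√(ε / M), by positivity, fun F hF hb => ?_⟩
  set δ := √(ε / M) with hδ
  have hδ0 : 0 ≤ δ := Real.sqrt_nonneg _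
  have hδ2 : δ ^ 2 * M = ε := by
    rw [hδ, Real.sq_sqrt (by positivity)]; field_simp
  have hsub : disc ⊆ ball (0 : ℂ) ρ := ball_subset_ball hρ.le
  refine ⟨hF.mono hsub, fun r hr hr1 => ?_, ?_⟩
  · refine Real.circleAverage_mono_on_of_le_circle
      (circleIntegrable_norm_sq (hF.mono hsub) hr hr1) fun z hz => ?_
    have := hb z (hsub (sphere_subset_disc hr hr1 hz))
    have e : ‖F z‖ ^ 2 ≤ δ ^ 2 := by gcongr
    have : 0 ≤ δ ^ 2 * (I / c ^ 2) := by positivity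
    nlinarith
  · have hd : ∀ z ∈ disc, ‖deriv F z‖ ≤ δ / c := fun z hz => by
      have hcb : closedBall z c ⊆ ball 0 ρ := by
        intro w hw
        rw [mem_closedBall, dist_eq_norm] at hw
        rw [mem_ball_zero_iff]
        have := norm_le_norm_add_norm_sub' w z
        linarith [mem_disc.1 hz]
      refine Complex.norm_deriv_le_of_forall_mem_sphere_norm_le hc0 ?_ fun w hw =>
        hb w (hcb (sphere_subset_closedBall hw))
      exact (hF.mono ((closure_ball z hc0.ne').symm ▸ hcb)).diffContOnCl
    calc _ ≤ ∫⁻ z in disc, ENNReal.ofReal (δ / c) ^ 2 * W μ z := by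
          refine setLIntegral_mono' measurableSet_disc fun z hz => ?_
          gcongr
          rw [← ofReal_norm]
          exact ENNReal.ofReal_le_ofReal (hd z hz)
      _ = ENNReal.ofReal ((δ / c) ^ 2 * I) := by
          rw [lintegral_const_mul _ (measurable_W μ), hIe, ← ENNReal.ofReal_pow (by positivity),
            ← ENNReal.ofReal_mul (by positivity)]
      _ ≤ _ := by
          apply ENNReal.ofReal_le_ofReal
          have : (δ / c) ^ 2 * I = δ ^ 2 * (I / c ^ 2) := by field_simp
          rw [this, ← hδ2]
          gcongr
          linarith

lemma exists_polynomial_small {μ : Measure ℂ} [IsFiniteMeasure μ] (hμ : OnCircle μ) {ρ : ℝ}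
    (hρ : 1 < ρ) {h : ℂ → ℂ} (hh : DifferentiableOn ℂ h (ball 0 ρ)) (ζ : ℂ) (n : ℕ) {ε : ℝ}
    (hε : 0 < ε) :
    ∃ q : Polynomial ℂ, Small μ ε (fun z => (z - ζ) ^ n * h z - q.eval z * (z - ζ) ^ n) := by
  set σ := (1 + ρ) / 2 with hσ
  have hσ1 : 1 < σ := by linarith
  obtain ⟨δ, hδ, hS⟩ := exists_small_of_bound hμ hσ1 hε
  set τ := (σ + ρ) / 2 with hτ
  have hτ0 : 0 < τ := by linarith
  lift τ to NNReal using hτ0.le with τ' hτ'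
  lift σ to NNReal using (by linarith) with σ' hσ'
  have hps := (hh.mono (closedBall_subset_ball (by linarith :
    (τ' : ℝ) < ρ))).hasFPowerSeriesOnBall (by exact_mod_cast hτ0)
  have hu := hps.tendstoUniformlyOn (r' := σ') (by
    have : (σ' : ℝ) < τ' := by linarith
    exact_mod_cast this)
  set K := (σ' + ‖ζ‖) ^ n with hK
  have hK0 : 0 < K := by have := norm_nonneg ζ; positivity
  rw [Metric.tendstoUniformlyOn_iff] at hu
  obtain ⟨N, hN⟩ := (hu (δ / K) (by positivity)).exists
  set p := cauchyPowerSeries h 0 τ' with hp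
  set q : Polynomial ℂ := ∑ j ∈ Finset.range N, Polynomial.C (p.coeff j) * Polynomial.X ^ j with hq
  have hqe : ∀ z, q.eval z = p.partialSum N z := fun z => by
    rw [hq, Polynomial.eval_finsetSum, FormalMultilinearSeries.partialSum]
    refine Finset.sum_congr rfl fun j _ => ?_
    rw [FormalMultilinearSeries.apply_eq_pow_smul_coeff]
    rw [Polynomial.eval_mul, Polynomial.eval_C, Polynomial.eval_pow, Polynomial.eval_X,
      smul_eq_mul, mul_comm]
  refine ⟨q, hS _ ?_ fun z hz => ?_⟩
  · have : DifferentiableOn ℂ h (ball 0 σ') := hh.mono (ball_subset_ball (by linarith))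
    have hqd := q.differentiable.differentiableOn (s := ball (0 : ℂ) σ')
    have hzd : DifferentiableOn ℂ (fun z : ℂ => (z - ζ) ^ n) (ball 0 σ') := by fun_prop
    exact (hzd.mul this).sub (hqd.mul hzd)
  · have e1 := hN z hz
    rw [zero_add, dist_eq_norm, ← hqe] at e1
    rw [mul_comm, ← sub_mul, norm_mul, norm_pow]
    have e2 : ‖z - ζ‖ ≤ σ' + ‖ζ‖ :=
      (norm_sub_le _ _).trans (by gcongr; exact (mem_ball_zero_iff.1 hz).le)
    have e3 : ‖z - ζ‖ ^ n ≤ K := by rw [hK]; gcongr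
    calc _ ≤ δ / K * K := by gcongr
      _ = δ := by field_simp

lemma tendsto_lintegral_min {μ : Measure ℂ} [IsFiniteMeasure μ] (hμ : OnCircle μ) :
    Tendsto (fun δ : ℝ => ∫⁻ z in disc, ENNReal.ofReal (min 3 (δ / (1 - ‖z‖))) ^ 2 * W μ z)
      (𝓝[>] 0) (𝓝 0) := by
  have hW := measurable_W μ
  rw [← lintegral_zero (μ := volume.restrict disc)]
  refine tendsto_lintegral_filter_of_dominated_convergence
    (fun z => ENNReal.ofReal 3 ^ 2 * W μ z) (Eventually.of_forall fun δ => by fun_prop)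
    (Eventually.of_forall fun δ => Eventually.of_forall fun z => ?_) ?_ ?_
  · gcongr; exact min_le_left _ _
  · rw [lintegral_const_mul _ hW]
    exact (ENNReal.mul_lt_top (ENNReal.pow_lt_top ENNReal.ofReal_lt_top)
      (lintegral_W_lt_top hμ)).ne
  · filter_upwards [ae_lt_top' hW.aemeasurable (lintegral_W_lt_top hμ).ne] with z hz
    have t1 : Tendsto (fun δ : ℝ => min 3 (δ / (1 - ‖z‖))) (𝓝[>] 0) (𝓝 (min 3 (0 / (1 - ‖z‖)))) :=
      (Continuous.tendsto (by fun_prop) 0).mono_left nhdsWithin_le_nhds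
    rw [zero_div, min_eq_right (by norm_num)] at t1
    have t2 := ((ENNReal.continuous_pow 2).tendsto _).comp (ENNReal.tendsto_ofReal t1)
    simpa [Function.comp_def] using ENNReal.Tendsto.mul_const t2 (Or.inr hz.ne)

lemma exists_small_mul {μ : Measure ℂ} [IsFiniteMeasure μ] (hμ : OnCircle μ) {g : ℂ → ℂ}
    (hg : DifferentiableOn ℂ g disc) {A : ℝ} (hA : ∀ z ∈ disc, ‖g z‖ ≤ A)
    (hA' : ∀ z ∈ disc, ‖deriv g z‖ ≤ A) (n : ℕ) {ε : ℝ} (hε : 0 < ε) :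
    ∃ δ > 0, ∀ ψ : ℂ → ℂ, Small μ δ ψ → (∀ z ∈ disc, ‖ψ z‖ ≤ 3) →
      (∀ z ∈ disc, ‖ψ z‖ ≤ δ / (1 - ‖z‖)) →
      Small μ ε (fun z => g z - (1 - ψ z) ^ n * g z) := by
  have hW := measurable_W μ
  have hA0 : 0 ≤ A := (norm_nonneg _).trans (hA 0 (mem_disc.2 (by simp)))
  set K := A * (n * 4 ^ n) + 1 with hK
  have hK1 : 1 ≤ K := by rw [hK]; linarith [show 0 ≤ A * (n * 4 ^ n) by positivity]
  have hK0 : 0 < K := by linarith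
  set κ := ε / (4 * K ^ 2) with hκ
  have hκ0 : 0 < κ := by positivity
  obtain ⟨δ, ⟨h1, h2⟩, h3⟩ := (((tendsto_lintegral_min hμ).eventually
    (Iic_mem_nhds (ENNReal.ofReal_pos.2 hκ0))).and
    ((eventually_le_nhds hκ0).filter_mono nhdsWithin_le_nhds) |>.and
      self_mem_nhdsWithin).exists
  refine ⟨δ, h3, fun ψ hψ hψ3 hψδ => ?_⟩
  have hpow : ∀ z ∈ disc, ∀ j ≤ n, ‖(1 - ψ z) ^ j‖ ≤ 4 ^ n := fun z hz j hj => by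
    have : ‖1 - ψ z‖ ≤ 4 := (norm_sub_le _ _).trans (by
      rw [norm_one]; linarith [hψ3 z hz])
    rw [norm_pow]
    calc _ ≤ (4 : ℝ) ^ j := by gcongr
      _ ≤ 4 ^ n := pow_le_pow_right₀ (by norm_num) hj
  have hsub : ∀ z ∈ disc, ‖1 - (1 - ψ z) ^ n‖ ≤ n * 4 ^ n * ‖ψ z‖ := fun z hz => by
    have e1 := mul_neg_geom_sum (1 - ψ z) n
    rw [sub_sub_cancel] at e1
    rw [← e1, norm_mul, mul_comm]
    gcongr
    refine (norm_sum_le _ _).trans ?_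
    refine (Finset.sum_le_card_nsmul _ _ (4 ^ n) fun j hj => hpow z hz j ?_).trans ?_
    · exact (Finset.mem_range.1 hj).le
    · simp
  have hG : ∀ z ∈ disc, ‖g z - (1 - ψ z) ^ n * g z‖ ≤ K * ‖ψ z‖ := fun z hz => by
    rw [← one_sub_mul, norm_mul]
    calc _ ≤ (n * 4 ^ n * ‖ψ z‖) * A := by gcongr; exacts [hsub z hz, hA z hz]
      _ ≤ K * ‖ψ z‖ := by rw [hK]; nlinarith [norm_nonneg (ψ z)]
  have hD : ∀ z ∈ disc, HasDerivAt (fun z => g z - (1 - ψ z) ^ n * g z)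
      ((1 - (1 - ψ z) ^ n) * deriv g z + n * (1 - ψ z) ^ (n - 1) * deriv ψ z * g z) z :=
    fun z hz => by
      have e1 := (differentiableAt_of_disc hg hz).hasDerivAt
      have e2 := (differentiableAt_of_disc hψ.diff hz).hasDerivAt
      refine (e1.sub (((e2.const_sub 1).pow n).mul e1)).congr_deriv ?_
      simp only [Pi.pow_apply]
      ring
  have hG' : ∀ z ∈ disc, ‖(1 - (1 - ψ z) ^ n) * deriv g z +
      n * (1 - ψ z) ^ (n - 1) * deriv ψ z * g z‖ ≤ K * ‖ψ z‖ + K * ‖deriv ψ z‖ := fun z hz => by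
    refine (norm_add_le _ _).trans (add_le_add ?_ ?_)
    · rw [norm_mul]
      calc _ ≤ (n * 4 ^ n * ‖ψ z‖) * A := by gcongr; exacts [hsub z hz, hA' z hz]
        _ ≤ K * ‖ψ z‖ := by rw [hK]; nlinarith [norm_nonneg (ψ z)]
    · rw [norm_mul, norm_mul, norm_mul, Complex.norm_natCast]
      calc _ ≤ n * 4 ^ n * ‖deriv ψ z‖ * A := by
            gcongr; exacts [hpow z hz (n - 1) (Nat.sub_le _ _), hA z hz]
        _ ≤ K * ‖deriv ψ z‖ := by rw [hK]; nlinarith [norm_nonneg (deriv ψ z)]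
  have hdiff : DifferentiableOn ℂ (fun z => g z - (1 - ψ z) ^ n * g z) disc :=
    fun z hz => (hD z hz).differentiableAt.differentiableWithinAt
  refine ⟨hdiff, fun r hr hr1 => ?_, ?_⟩
  · calc _ ≤ Real.circleAverage (fun z => (K ^ 2) • ‖ψ z‖ ^ 2) 0 r := by
          refine Real.circleAverage_mono (circleIntegrable_norm_sq hdiff hr hr1)
            (circleIntegrable_norm_sq hψ.diff hr hr1).const_smul fun z hz => ?_
          rw [smul_eq_mul, ← mul_pow]
          gcongr
          exact hG z (sphere_subset_disc hr hr1 hz)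
      _ ≤ K ^ 2 * κ := by
          rw [Real.circleAverage_fun_smul, smul_eq_mul]
          gcongr
          exact (hψ.mean r hr hr1).trans h2
      _ ≤ ε := by rw [hκ]; field_simp; linarith
  · have mψ' := measurable_deriv ψ
    calc _ ≤ ∫⁻ z in disc, (ENNReal.ofReal (2 * K ^ 2) *
          (ENNReal.ofReal (min 3 (δ / (1 - ‖z‖))) ^ 2 * W μ z) +
          ENNReal.ofReal (2 * K ^ 2) * (‖deriv ψ z‖ₑ ^ 2 * W μ z)) := by
          refine setLIntegral_mono' measurableSet_disc fun z hz => ?_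
          rw [(hD z hz).deriv, ← mul_assoc, ← mul_assoc, ← add_mul]
          gcongr
          have e1 : ‖ψ z‖ ≤ min 3 (δ / (1 - ‖z‖)) := le_min (hψ3 z hz) (hψδ z hz)
          have e0 := (norm_nonneg _).trans e1
          rw [← ofReal_norm, ← ofReal_norm, ← ENNReal.ofReal_pow (by positivity),
            ← ENNReal.ofReal_pow e0, ← ENNReal.ofReal_pow (by positivity),
            ← ENNReal.ofReal_mul (by positivity), ← ENNReal.ofReal_mul (by positivity)]
          rw [← ENNReal.ofReal_add (by positivity) (by positivity)]
          apply ENNReal.ofReal_le_ofReal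
          calc _ ≤ (K * min 3 (δ / (1 - ‖z‖)) + K * ‖deriv ψ z‖) ^ 2 := by
                gcongr
                exact (hG' z hz).trans (by gcongr)
            _ ≤ _ := by nlinarith [sq_nonneg (K * min 3 (δ / (1 - ‖z‖)) - K * ‖deriv ψ z‖)]
      _ = ENNReal.ofReal (2 * K ^ 2) *
            (∫⁻ z in disc, ENNReal.ofReal (min 3 (δ / (1 - ‖z‖))) ^ 2 * W μ z) +
          ENNReal.ofReal (2 * K ^ 2) * ∫⁻ z in disc, ‖deriv ψ z‖ₑ ^ 2 * W μ z := by
          rw [lintegral_add_left (by fun_prop), lintegral_const_mul _ (by fun_prop),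
            lintegral_const_mul _ (by fun_prop)]
      _ ≤ ENNReal.ofReal (2 * K ^ 2) * ENNReal.ofReal κ +
          ENNReal.ofReal (2 * K ^ 2) * ENNReal.ofReal κ := by
          gcongr
          exact hψ.energy.trans (ENNReal.ofReal_le_ofReal h2)
      _ = ENNReal.ofReal ε := by
          rw [← ENNReal.ofReal_mul (by positivity),
            ← ENNReal.ofReal_add (by positivity) (by positivity)]
          congr 1
          rw [hκ]; field_simp; norm_num

lemma norm_bpt (t : ℝ) : ‖bpt t‖ = 1 := by
  rw [bpt, mul_comm, Complex.norm_exp_ofReal_mul_I]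

lemma continuous_bpt : Continuous bpt := by unfold bpt; fun_prop

lemma one_sub_norm_le_norm_bpt_sub (t : ℝ) (z : ℂ) : 1 - ‖z‖ ≤ ‖bpt t - z‖ := by
  rw [← norm_bpt t]; exact norm_sub_norm_le _ _

lemma bpt_sub_ne_zero (t : ℝ) {z : ℂ} (hz : ‖z‖ < 1) : bpt t - z ≠ 0 :=
  norm_pos_iff.1 (by linarith [one_sub_norm_le_norm_bpt_sub t z])

/-- The Herglotz transform of a boundary function, whose real part is the Poisson extension. -/
def herglotz (u : ℝ → ℝ) (z : ℂ) : ℂ :=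
  ((2 * Real.pi)⁻¹ : ℝ) • ∫ t, ((bpt t + z) / (bpt t - z)) * (u t : ℂ) ∂θm

lemma norm_herglotz_kernel_le (t : ℝ) {z : ℂ} (hz : ‖z‖ < 1) :
    ‖(bpt t + z) / (bpt t - z)‖ ≤ 2 / (1 - ‖z‖) := by
  rw [norm_div]
  have h0 : 0 < 1 - ‖z‖ := by linarith
  gcongr
  · calc _ ≤ ‖bpt t‖ + ‖z‖ := norm_add_le _ _
      _ ≤ 2 := by rw [norm_bpt]; linarith
  · exact one_sub_norm_le_norm_bpt_sub t z

lemma aestronglyMeasurable_herglotz {u : ℝ → ℝ} (hu : Integrable u θm) (z : ℂ) :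
    AEStronglyMeasurable (fun t => ((bpt t + z) / (bpt t - z)) * (u t : ℂ)) θm := by
  have := continuous_bpt.measurable
  refine AEStronglyMeasurable.mul (Measurable.aestronglyMeasurable (by fun_prop)) ?_
  exact hu.ofReal.aestronglyMeasurable

lemma integrable_herglotz {u : ℝ → ℝ} (hu : Integrable u θm) {z : ℂ} (hz : ‖z‖ < 1) :
    Integrable (fun t => ((bpt t + z) / (bpt t - z)) * (u t : ℂ)) θm := by
  refine (hu.norm.const_mul (2 / (1 - ‖z‖))).mono' (aestronglyMeasurable_herglotz hu z)
    (Eventually.of_forall fun t => ?_)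
  rw [norm_mul, Complex.norm_real]
  gcongr
  exact norm_herglotz_kernel_le t hz

lemma differentiableAt_herglotz {u : ℝ → ℝ} (hu : Integrable u θm) {z₀ : ℂ} (hz₀ : ‖z₀‖ < 1) :
    DifferentiableAt ℂ (herglotz u) z₀ := by
  have hη : 0 < (1 - ‖z₀‖) / 2 := by linarith
  have hb : ∀ z ∈ ball z₀ ((1 - ‖z₀‖) / 2), (1 - ‖z₀‖) / 2 ≤ 1 - ‖z‖ := by
    intro z hz
    have h1 : ‖z - z₀‖ < (1 - ‖z₀‖) / 2 := mem_ball_iff_norm.1 hz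
    linarith [norm_sub_norm_le z z₀]
  have hc := continuous_bpt.measurable
  have key := (hasDerivAt_integral_of_dominated_loc_of_deriv_le (μ := θm) (𝕜 := ℂ)
    (F := fun z t => ((bpt t + z) / (bpt t - z)) * (u t : ℂ))
    (F' := fun z t => (2 * bpt t / (bpt t - z) ^ 2) * (u t : ℂ))
    (bound := fun t => 2 / ((1 - ‖z₀‖) / 2) ^ 2 * ‖u t‖)
    (ball_mem_nhds z₀ hη)
    (Eventually.of_forall fun z => aestronglyMeasurable_herglotz hu z)
    (integrable_herglotz hu hz₀)
    (AEStronglyMeasurable.mul (Measurable.aestronglyMeasurable (by fun_prop))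
      hu.ofReal.aestronglyMeasurable)
    (Eventually.of_forall fun t z hz => ?_) (hu.norm.const_mul _)
    (Eventually.of_forall fun t z hz => ?_)).2
  · exact key.differentiableAt.const_smul (2 * Real.pi)⁻¹
  · have h1 := hb z hz
    rw [norm_mul, Complex.norm_real, norm_div, norm_mul, norm_pow, norm_bpt, Complex.norm_ofNat,
      mul_one]
    have := h1.trans (one_sub_norm_le_norm_bpt_sub t z)
    gcongr
  · have h1 := hb z hz
    have hne := bpt_sub_ne_zero t (z := z) (by linarith)
    refine HasDerivAt.mul_const ?_ _
    refine (((hasDerivAt_id z).const_add (bpt t)).div ((hasDerivAt_id z).const_sub (bpt t))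
      hne).congr_deriv ?_
    simp only [id]
    ring

lemma herglotz_kernel_re (t : ℝ) {z : ℂ} (hz : ‖z‖ < 1) :
    ((bpt t + z) / (bpt t - z)).re = (1 - ‖z‖ ^ 2) / ‖bpt t - z‖ ^ 2 := by
  have h1 : ‖bpt t‖ ^ 2 = 1 := by rw [norm_bpt]; norm_num
  have hne : Complex.normSq (bpt t - z) ≠ 0 := by
    rw [Ne, Complex.normSq_eq_zero]; exact bpt_sub_ne_zero t hz
  rw [← h1, ← Complex.normSq_eq_norm_sq, ← Complex.normSq_eq_norm_sq, ← Complex.normSq_eq_norm_sq,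
    Complex.div_re]
  field_simp
  simp only [Complex.normSq_apply, Complex.add_re, Complex.add_im, Complex.sub_re, Complex.sub_im]
  ring

lemma re_herglotz {u : ℝ → ℝ} (hu : Integrable u θm) {z : ℂ} (hz : ‖z‖ < 1) :
    (herglotz u z).re = poissonExt u z := by
  rw [herglotz, Complex.smul_re, poissonExt, smul_eq_mul, one_div,
    intervalIntegral.integral_of_le (by positivity)]
  congr 1
  rw [← Complex.reCLM_apply, ← Complex.reCLM.integral_comp_comm (integrable_herglotz hu hz), θm]
  refine integral_congr_ae (Eventually.of_forall fun t => ?_)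
  simp only [Complex.reCLM_apply, Complex.re_mul_ofReal, herglotz_kernel_re t hz]

lemma norm_herglotz_le {u : ℝ → ℝ} (hu : Integrable u θm) (h0 : ∀ t, 0 ≤ u t) {z : ℂ}
    (hz : ‖z‖ < 1) :
    ‖herglotz u z‖ ≤ 2 / (1 - ‖z‖) * ((2 * Real.pi)⁻¹ * ∫ t, u t ∂θm) := by
  rw [herglotz, norm_smul, Real.norm_eq_abs, abs_of_nonneg (by positivity), mul_left_comm]
  gcongr
  rw [← integral_const_mul]
  refine norm_integral_le_of_norm_le (hu.const_mul _) (Eventually.of_forall fun t => ?_)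
  rw [norm_mul, Complex.norm_real, Real.norm_eq_abs, abs_of_nonneg (h0 t)]
  gcongr
  · exact h0 t
  · exact norm_herglotz_kernel_le t hz

lemma norm_deriv_le_norm_fderiv_re {f : ℂ → ℂ} {z : ℂ} (hf : DifferentiableAt ℂ f z) :
    ‖deriv f z‖ ≤ ‖fderiv ℝ (fun w => (f w).re) z‖ := by
  have h1 : HasFDerivAt (fun w => (f w).re)
      (Complex.reCLM.comp ((ContinuousLinearMap.toSpanSingleton ℂ (deriv f z)).restrictScalars ℝ))
      z := Complex.reCLM.hasFDerivAt.comp z (hf.hasDerivAt.hasFDerivAt.restrictScalars ℝ)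
  set a := deriv f z
  rcases eq_or_ne a 0 with ha | ha
  · rw [ha, norm_zero]; exact norm_nonneg _
  have hpos : 0 < ‖a‖ := norm_pos_iff.2 ha
  have h2 := (fderiv ℝ (fun w => (f w).re) z).le_opNorm ((starRingEnd ℂ) a)
  rw [h1.fderiv] at h2 ⊢
  simp only [ContinuousLinearMap.comp_apply, ContinuousLinearMap.coe_restrictScalars',
    ContinuousLinearMap.toSpanSingleton_apply, Complex.reCLM_apply, smul_eq_mul,
    RCLike.norm_conj] at h2
  rw [mul_comm ((starRingEnd ℂ) a), Complex.mul_conj, Complex.ofReal_re,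
    Complex.normSq_eq_norm_sq, Real.norm_eq_abs, abs_of_nonneg (by positivity), sq] at h2
  exact le_of_mul_le_mul_right h2 hpos

lemma poissonExt_one {z : ℂ} (hz : ‖z‖ < 1) : poissonExt (fun _ => 1) z = 1 := by
  have h := DiffContOnCl.circleAverage_poissonKernel_smul' (f := fun _ : ℂ => (1 : ℂ)) (c := 0)
    (R := 1) (w := z) diffContOnCl_const (by simpa using hz)
  have h2 : Real.circleAverage (fun w => (1 - ‖z‖ ^ 2) / ‖w - z‖ ^ 2) 0 1 = 1 := by
    have hc : Continuous fun t => (1 - ‖z‖ ^ 2) / ‖bpt t - z‖ ^ 2 :=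
      continuous_const.div (((continuous_bpt.sub continuous_const).norm).pow 2) fun t =>
        pow_ne_zero 2 (norm_ne_zero_iff.2 (bpt_sub_ne_zero t hz))
    rw [← Complex.ofReal_inj, Complex.ofReal_one, ← h, Real.circleAverage_def,
      Real.circleAverage_def, smul_eq_mul, Complex.real_smul, Complex.ofReal_mul,
      ← intervalIntegral.integral_ofReal]
    congr 1
    refine intervalIntegral.integral_congr fun t _ => ?_
    simp
  rw [circleAverage_eq] at h2
  rw [poissonExt]
  simpa using h2

lemma θm_univ : θm univ = ENNReal.ofReal (2 * Real.pi) := by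
  simp [θm]

instance : IsFiniteMeasure θm := ⟨by rw [θm_univ]; exact ENNReal.ofReal_lt_top⟩

lemma poissonExt_eq (u : ℝ → ℝ) (z : ℂ) : poissonExt u z =
    (2 * Real.pi)⁻¹ * ∫ t, ((1 - ‖z‖ ^ 2) / ‖bpt t - z‖ ^ 2) * u t ∂θm := by
  rw [poissonExt, one_div, intervalIntegral.integral_of_le (by positivity), θm]

lemma integrable_poisson_mul {u : ℝ → ℝ} (hu : Integrable u θm) {z : ℂ} (hz : ‖z‖ < 1) :
    Integrable (fun t => ((1 - ‖z‖ ^ 2) / ‖bpt t - z‖ ^ 2) * u t) θm := by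
  refine (integrable_herglotz hu hz).re.congr (Eventually.of_forall fun t => ?_)
  simp only [RCLike.re_to_complex, Complex.re_mul_ofReal, herglotz_kernel_re t hz]

lemma le_poissonExt {u : ℝ → ℝ} (hu : Integrable u θm) (h0 : ∀ t, 0 ≤ u t) {U : Set ℂ}
    (h1 : ∀ᵐ t ∂θm, bpt t ∈ U → 1 ≤ u t) {ζ : ℂ} (hζ : ‖ζ‖ = 1) {η : ℝ} (hη : 0 < η)
    (hU : ∀ w, ‖w‖ = 1 → ‖w - ζ‖ < η → w ∈ U) {r : ℝ} (hr : 0 < r) (hr1 : r < 1)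
    (hrη : 1 - r ≤ η / 2) :
    1 - 4 * (1 - r ^ 2) / η ^ 2 ≤ poissonExt u (r * ζ) := by
  have hz : ‖(r : ℂ) * ζ‖ = r := by
    rw [norm_mul, hζ, mul_one, Complex.norm_real, Real.norm_eq_abs, abs_of_pos hr]
  have hz1 : ‖(r : ℂ) * ζ‖ < 1 := hz.trans_lt hr1
  have hr2 : 0 ≤ 1 - r ^ 2 := by nlinarith
  have i1 := integrable_poisson_mul (integrable_const (1 : ℝ)) hz1
  have i2 := integrable_poisson_mul hu hz1
  have key : ∫ t, ((1 - ‖(r : ℂ) * ζ‖ ^ 2) / ‖bpt t - r * ζ‖ ^ 2) * 1 ∂θm ≤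
      ∫ t, (((1 - ‖(r : ℂ) * ζ‖ ^ 2) / ‖bpt t - r * ζ‖ ^ 2) * u t +
        4 * (1 - r ^ 2) / η ^ 2) ∂θm := by
    refine integral_mono_ae i1 (i2.add (integrable_const _)) ?_
    filter_upwards [h1] with t ht
    rw [hz]
    by_cases hw : ‖bpt t - ζ‖ < η
    · have := ht (hU _ (norm_bpt t) hw)
      have h3 : 0 ≤ 4 * (1 - r ^ 2) / η ^ 2 := by positivity
      have h4 : (1 - r ^ 2) / ‖bpt t - r * ζ‖ ^ 2 * 1 ≤ (1 - r ^ 2) / ‖bpt t - r * ζ‖ ^ 2 * u t := by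
        gcongr
      linarith
    · have h5 : η / 2 ≤ ‖bpt t - r * ζ‖ := by
        have h6 : ‖(1 - r : ℂ) * ζ‖ = 1 - r := by
          rw [norm_mul, hζ, mul_one, ← Complex.ofReal_one, ← Complex.ofReal_sub, Complex.norm_real,
            Real.norm_eq_abs, abs_of_nonneg (by linarith)]
        have h7 := norm_sub_le (bpt t - r * ζ) ((1 - r : ℂ) * ζ)
        have h8 : bpt t - r * ζ - (1 - r : ℂ) * ζ = bpt t - ζ := by ring
        rw [h8, h6] at h7
        linarith
      have h9 : (1 - r ^ 2) / ‖bpt t - r * ζ‖ ^ 2 ≤ 4 * (1 - r ^ 2) / η ^ 2 := by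
        calc _ ≤ (1 - r ^ 2) / (η / 2) ^ 2 := by gcongr
          _ = _ := by field_simp; norm_num
      have h10 : 0 ≤ (1 - r ^ 2) / ‖bpt t - r * ζ‖ ^ 2 * u t :=
        mul_nonneg (by positivity) (h0 t)
      linarith
  rw [integral_add i2 (integrable_const _), integral_const, measureReal_def, θm_univ,
    ENNReal.toReal_ofReal (by positivity), smul_eq_mul] at key
  have e1 := poissonExt_one hz1
  rw [poissonExt_eq] at e1 ⊢
  have hp : 0 < (2 * Real.pi)⁻¹ := by positivity
  have := mul_le_mul_of_nonneg_left key hp.le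
  rw [e1, mul_add, inv_mul_cancel_left₀ (by positivity)] at this
  linarith

lemma exists_of_cap_zero {μ : Measure ℂ} {ζ : ℂ} (hcap : cap μ {ζ} = 0) {ε : ℝ} (hε : 0 < ε) :
    ∃ U u, RelOpen U ∧ ζ ∈ U ∧ MemDh μ u ∧ (∀ t, 0 ≤ u t) ∧
      (∀ᵐ t ∂θm, bpt t ∈ U → 1 ≤ u t) ∧ dhNormSq μ u < ε := by
  have h : cap μ {ζ} < ENNReal.ofReal ε := hcap ▸ ENNReal.ofReal_pos.2 hε
  simp only [cap, capOpen, iInf_lt_iff] at h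
  obtain ⟨U, ⟨hU, hζU⟩, u, ⟨h1, h2, h3⟩, h4⟩ := h
  exact ⟨U, u, hU, singleton_subset_iff.1 hζU, h1, h2, h3, (ENNReal.ofReal_lt_ofReal_iff hε).1 h4⟩

lemma gradDensity_nonneg (μ : Measure ℂ) (u : ℝ → ℝ) {z : ℂ} (hz : z ∈ disc) :
    0 ≤ gradDensity μ u z :=
  mul_nonneg (by positivity) (poissonMu_nonneg μ (mem_disc.1 hz))

lemma MemDh.integrable {μ : Measure ℂ} {u : ℝ → ℝ} (hu : MemDh μ u) (h0 : ∀ t, 0 ≤ u t) :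
    Integrable u θm := by
  have hm : AEStronglyMeasurable u θm := by
    have : u = fun t => √(u t ^ 2) := funext fun t => (Real.sqrt_sq (h0 t)).symm
    rw [this]
    exact Real.continuous_sqrt.comp_aestronglyMeasurable hu.1.aestronglyMeasurable
  refine (hu.1.add (integrable_const (μ := θm) (1 : ℝ))).mono' hm (Eventually.of_forall fun t => ?_)
  rw [Real.norm_eq_abs, abs_of_nonneg (h0 t), Pi.add_apply]
  nlinarith [sq_nonneg (u t - 1), h0 t]

lemma mean_le_of_dhNormSq_lt {μ : Measure ℂ} {u : ℝ → ℝ} (hu : MemDh μ u) (h0 : ∀ t, 0 ≤ u t)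
    {ε : ℝ} (hε : 0 < ε) (h : dhNormSq μ u < ε ^ 2) :
    (2 * Real.pi)⁻¹ * ∫ t, u t ∂θm ≤ ε := by
  have h1 : 0 ≤ ∫ z in disc, gradDensity μ u z :=
    setIntegral_nonneg measurableSet_disc fun z hz => gradDensity_nonneg μ u hz
  have h2 : (2 * Real.pi)⁻¹ * ∫ t, u t ^ 2 ∂θm ≤ ε ^ 2 := by
    have h3 : 0 ≤ 1 / Real.pi * ∫ z in disc, gradDensity μ u z := by positivity
    rw [dhNormSq, one_div] at h
    rw [θm]
    linarith
  have i2 : Integrable (fun t => 1 / (2 * ε) * u t ^ 2) θm := Integrable.const_mul hu.1 _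
  have h4 : ∫ t, u t ∂θm ≤ ∫ t, (1 / (2 * ε) * u t ^ 2 + ε / 2) ∂θm := by
    refine integral_mono (hu.integrable h0) (i2.add (integrable_const _)) fun t => ?_
    have : 1 / (2 * ε) * u t ^ 2 + ε / 2 - u t = (u t - ε) ^ 2 / (2 * ε) := by field_simp; ring
    have h5 : 0 ≤ (u t - ε) ^ 2 / (2 * ε) := by positivity
    simp only
    linarith
  rw [integral_add i2 (integrable_const _), integral_const_mul, integral_const,
    measureReal_def, θm_univ, ENNReal.toReal_ofReal (by positivity), smul_eq_mul] at h4
  have hp : 0 < (2 * Real.pi)⁻¹ := by positivity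
  have h6 := mul_le_mul_of_nonneg_left h4 hp.le
  rw [mul_add, inv_mul_cancel_left₀ (by positivity), mul_left_comm] at h6
  have h7 : 1 / (2 * ε) * ((2 * Real.pi)⁻¹ * ∫ t, u t ^ 2 ∂θm) ≤ 1 / (2 * ε) * ε ^ 2 := by gcongr
  have h8 : 1 / (2 * ε) * ε ^ 2 = ε / 2 := by field_simp
  linarith

lemma energy_le_of_dhNormSq_lt {μ : Measure ℂ} [IsFiniteMeasure μ] (hμ : OnCircle μ) {u : ℝ → ℝ}
    (hu : MemDh μ u) {ε : ℝ} (h : dhNormSq μ u < ε) :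
    ∫⁻ z in disc, ‖fderiv ℝ (poissonExt u) z‖ₑ ^ 2 * W μ z ≤ ENNReal.ofReal (4 * ε) := by
  have h1 : 0 ≤ ∫ z in disc, gradDensity μ u z :=
    setIntegral_nonneg measurableSet_disc fun z hz => gradDensity_nonneg μ u hz
  have h2 : 0 ≤ 1 / (2 * Real.pi) * ∫ t in Ioc 0 (2 * Real.pi), u t ^ 2 :=
    mul_nonneg (by positivity) (integral_nonneg fun t => by positivity)
  have h3 : ∫ z in disc, gradDensity μ u z ≤ 4 * ε := by
    have h4 : 1 / Real.pi * ∫ z in disc, gradDensity μ u z ≤ ε := by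
      unfold dhNormSq at h; linarith
    rw [one_div, inv_mul_le_iff₀ Real.pi_pos] at h4
    nlinarith [Real.pi_lt_four, Real.pi_pos]
  refine le_trans (le_of_eq ?_) (ENNReal.ofReal_le_ofReal h3)
  rw [ofReal_integral_eq_lintegral_ofReal hu.2
    (ae_restrict_of_forall_mem measurableSet_disc fun z hz => gradDensity_nonneg μ u hz)]
  refine setLIntegral_congr_fun measurableSet_disc fun z hz => ?_
  simp only [gradDensity]
  rw [ENNReal.ofReal_mul (by positivity), ofReal_poissonMu hμ (mem_disc.1 hz),
    ENNReal.ofReal_pow (by positivity), ofReal_norm]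

lemma exists_holomorphic_of_cap_zero {μ : Measure ℂ} [IsFiniteMeasure μ] (hμ : OnCircle μ) {ζ : ℂ}
    (hζ : ‖ζ‖ = 1) (hcap : cap μ {ζ} = 0) {ε : ℝ} (hε : 0 < ε) :
    ∃ f : ℂ → ℂ, DifferentiableOn ℂ f disc ∧ (∀ z ∈ disc, 0 ≤ (f z).re) ∧
      (∀ z ∈ disc, ‖f z‖ ≤ ε / (1 - ‖z‖)) ∧
      ∫⁻ z in disc, ‖deriv f z‖ₑ ^ 2 * W μ z ≤ ENNReal.ofReal ε ∧
      ∃ r₀ < 1, ∀ r : ℝ, r₀ < r → r < 1 → 1 / 2 ≤ (f (r * ζ)).re := by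
  have hδ : 0 < min (ε / 4) ((ε / 2) ^ 2) := by positivity
  obtain ⟨U, u, ⟨V, hV, rfl⟩, hζU, hu, h0, h1, hlt⟩ := exists_of_cap_zero hcap hδ
  have hi := hu.integrable h0
  have hM := mean_le_of_dhNormSq_lt hu h0 (half_pos hε) (hlt.trans_le (min_le_right _ _))
  have hE := energy_le_of_dhNormSq_lt hμ hu (hlt.trans_le (min_le_left _ _))
  rw [mul_div_cancel₀ _ (by norm_num : (4 : ℝ) ≠ 0)] at hE
  obtain ⟨η, hη, hball⟩ := Metric.isOpen_iff.1 hV ζ hζU.1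
  have hd : DifferentiableOn ℂ (herglotz u) disc := fun z hz =>
    (differentiableAt_herglotz hi (mem_disc.1 hz)).differentiableWithinAt
  refine ⟨herglotz u, hd, fun z hz => ?_, fun z hz => ?_, ?_, max (max 0 (1 - η / 2))
    (1 - η ^ 2 / 16), ?_, fun r hr hr1 => ?_⟩
  · have hz1 := mem_disc.1 hz
    have : 0 ≤ 1 - ‖z‖ ^ 2 := by nlinarith [norm_nonneg z]
    rw [re_herglotz hi hz1, poissonExt_eq]
    exact mul_nonneg (by positivity) (integral_nonneg fun t => mul_nonneg (by positivity) (h0 t))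
  · have hz1 : 0 < 1 - ‖z‖ := by linarith [mem_disc.1 hz]
    calc _ ≤ 2 / (1 - ‖z‖) * (ε / 2) :=
          (norm_herglotz_le hi h0 (mem_disc.1 hz)).trans (by gcongr)
      _ = _ := by ring
  · refine le_trans (setLIntegral_mono' measurableSet_disc fun z hz => ?_) hE
    have h2 := norm_deriv_le_norm_fderiv_re (differentiableAt_of_disc hd hz)
    have h3 : (fun w => (herglotz u w).re) =ᶠ[𝓝 z] poissonExt u := by
      filter_upwards [isOpen_ball.mem_nhds hz] with w hw
      exact re_herglotz hi (mem_disc.1 hw)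
    rw [h3.fderiv_eq] at h2
    gcongr
    exact enorm_le_iff_norm_le.2 h2
  · have : 0 < η ^ 2 := by positivity
    exact max_lt (max_lt one_pos (by linarith)) (by linarith)
  · have h3 := (le_max_right _ _).trans_lt hr
    have h4 := (le_max_left _ _).trans_lt hr
    have h5 := (le_max_left _ _).trans_lt h4
    have h6 := (le_max_right _ _).trans_lt h4
    have hz : ‖(r : ℂ) * ζ‖ < 1 := by
      rwa [norm_mul, hζ, mul_one, Complex.norm_real, Real.norm_eq_abs, abs_of_pos h5]
    rw [re_herglotz hi hz]
    refine le_trans ?_ (le_poissonExt hi h0 h1 hζ hη (fun w hw hw' =>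
      ⟨hball (mem_ball_iff_norm.2 hw'), mem_sphere_zero_iff_norm.2 hw⟩) h5 hr1 (by linarith))
    have : 4 * (1 - r ^ 2) / η ^ 2 ≤ 1 / 2 := by
      rw [div_le_iff₀ (by positivity)]
      nlinarith
    linarith

lemma one_le_norm_one_add {w : ℂ} (hw : 0 ≤ w.re) : 1 ≤ ‖1 + w‖ := by
  have := Complex.re_le_norm (1 + w)
  rw [Complex.add_re, Complex.one_re] at this
  linarith

lemma normSq_one_add (w : ℂ) : ‖1 + w‖ ^ 2 = 1 + 2 * w.re + ‖w‖ ^ 2 := by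
  simp only [← Complex.normSq_eq_norm_sq, Complex.normSq_apply, Complex.add_re, Complex.add_im,
    Complex.one_re, Complex.one_im]
  ring

lemma norm_div_one_add_le_one {w : ℂ} (hw : 0 ≤ w.re) : ‖w / (1 + w)‖ ≤ 1 := by
  have h := one_le_norm_one_add hw
  rw [norm_div, div_le_one (by linarith)]
  nlinarith [normSq_one_add w, norm_nonneg w]

lemma norm_div_one_add_le {w : ℂ} (hw : 0 ≤ w.re) : ‖w / (1 + w)‖ ≤ ‖w‖ := by
  rw [norm_div]
  exact div_le_self (norm_nonneg w) (one_le_norm_one_add hw)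

lemma norm_sq_div_one_add_le_re {w : ℂ} (hw : 0 ≤ w.re) :
    ‖w / (1 + w)‖ ^ 2 ≤ (w / (1 + w)).re := by
  have h := one_le_norm_one_add hw
  have h2 : 0 < ‖1 + w‖ ^ 2 := by positivity
  rw [norm_div, div_pow, Complex.div_re, ← add_div, Complex.normSq_eq_norm_sq]
  gcongr
  simp only [← Complex.normSq_eq_norm_sq, Complex.normSq_apply, Complex.add_re, Complex.add_im,
    Complex.one_re, Complex.one_im]
  linarith

lemma one_third_le_norm_div_one_add {w : ℂ} (hw : 1 / 2 ≤ w.re) : 1 / 3 ≤ ‖w / (1 + w)‖ := by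
  have h := one_le_norm_one_add (w := w) (by linarith)
  have h2 := norm_add_le 1 w
  rw [norm_one] at h2
  rw [norm_div, div_le_div_iff₀ (by norm_num) (by linarith)]
  linarith [Complex.re_le_norm w]

lemma circleAverage_re {F : ℂ → ℂ} (hF : DifferentiableOn ℂ F disc) {r : ℝ} (hr : 0 < r)
    (hr1 : r < 1) : CircleIntegrable (fun z => (F z).re) 0 r ∧
      Real.circleAverage (fun z => (F z).re) 0 r = (F 0).re := by
  have hc : closure (ball (0 : ℂ) |r|) ⊆ disc := by
    rw [closure_ball _ (abs_pos.2 hr.ne').ne', abs_of_pos hr]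
    exact closedBall_subset_ball hr1
  have hci : CircleIntegrable F 0 r :=
    (hF.continuousOn.mono (sphere_subset_disc hr hr1)).circleIntegrable'
  have h := (hF.mono hc).diffContOnCl.circleAverage
  refine ⟨ContinuousOn.circleIntegrable' (Complex.continuous_re.comp_continuousOn
    (hF.continuousOn.mono (sphere_subset_disc hr hr1))), ?_⟩
  have h2 := Complex.reCLM.circleAverage_comp_comm hci
  rw [h] at h2
  exact h2

lemma exists_bump {μ : Measure ℂ} [IsFiniteMeasure μ] (hμ : OnCircle μ) {ζ : ℂ} (hζ : ‖ζ‖ = 1)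
    (hcap : cap μ {ζ} = 0) {δ : ℝ} (hδ : 0 < δ) :
    ∃ ψ : ℂ → ℂ, ∃ ρ > 1, DifferentiableOn ℂ ψ (ball 0 ρ) ∧ ψ ζ = 1 ∧ Small μ δ ψ ∧
      (∀ z ∈ disc, ‖ψ z‖ ≤ 3) ∧ ∀ z ∈ disc, ‖ψ z‖ ≤ δ / (1 - ‖z‖) := by
  obtain ⟨f, hf, hre, hbd, hE, r₀, hr₀, hr₀f⟩ :=
    exists_holomorphic_of_cap_zero hμ hζ hcap (ε := δ / 11808) (by positivity)
  obtain ⟨r, hr, hr1⟩ := exists_between (max_lt hr₀ (by norm_num : (1 / 2 : ℝ) < 1))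
  have hrh : 1 / 2 ≤ r := ((le_max_right _ _).trans_lt hr).le
  have hr0 : 0 < r := by linarith
  have hfr := hr₀f r ((le_max_left _ _).trans_lt hr) hr1
  have hne : ∀ z ∈ disc, 1 + f z ≠ 0 := fun z hz =>
    norm_pos_iff.1 (one_pos.trans_le (one_le_norm_one_add (hre z hz)))
  set φ : ℂ → ℂ := fun z => f z / (1 + f z) with hφ
  have hφd : DifferentiableOn ℂ φ disc := hf.div (hf.const_add 1) hne
  have hφ' : ∀ z ∈ disc, ‖deriv φ z‖ₑ ≤ ‖deriv f z‖ₑ := by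
    intro z hz
    have h1 := (differentiableAt_of_disc hf hz).hasDerivAt
    have h2 : HasDerivAt φ (deriv f z / (1 + f z) ^ 2) z :=
      (h1.div (h1.const_add 1) (hne z hz)).congr_deriv (by ring)
    rw [h2.deriv, enorm_le_iff_norm_le, norm_div, norm_pow]
    exact div_le_self (norm_nonneg _) (one_le_pow₀ (one_le_norm_one_add (hre z hz)))
  have hrn : ∀ z : ℂ, ‖(r : ℂ) * z‖ = r * ‖z‖ := fun z => by
    rw [norm_mul, Complex.norm_real, Real.norm_eq_abs, abs_of_pos hr0]
  have hrz : ∀ z ∈ ball (0 : ℂ) (1 / r), (r : ℂ) * z ∈ disc := by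
    intro z hz
    rw [mem_ball_zero_iff, lt_div_iff₀ hr0] at hz
    rw [mem_disc, hrn]
    linarith
  have hsub : disc ⊆ ball (0 : ℂ) (1 / r) :=
    ball_subset_ball ((one_le_div hr0).2 hr1.le)
  set C := (φ (r * ζ))⁻¹ with hC
  have h13 : 1 / 3 ≤ ‖φ (r * ζ)‖ := one_third_le_norm_div_one_add hfr
  have hC3 : ‖C‖ ≤ 3 := by
    rw [hC, norm_inv]
    exact inv_le_of_inv_le₀ (by norm_num) (by linarith)
  have hψd : DifferentiableOn ℂ (fun z => C * φ (r * z)) (ball 0 (1 / r)) :=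
    (hφd.comp (by fun_prop) hrz).const_mul C
  refine ⟨fun z => C * φ (r * z), 1 / r, (one_lt_div hr0).2 hr1, hψd, ?_,
    ⟨hψd.mono hsub, fun s hs hs1 => ?_, ?_⟩, fun z hz => ?_, fun z hz => ?_⟩
  · exact inv_mul_cancel₀ (norm_pos_iff.1 (by linarith))
  · have hG : DifferentiableOn ℂ (fun z => φ (r * z)) disc :=
      hφd.comp (by fun_prop) fun z hz => hrz z (hsub hz)
    obtain ⟨h1, h2⟩ := circleAverage_re hG hs hs1
    have h0 : ((0 : ℂ) : ℂ) ∈ disc := mem_disc.2 (by simp)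
    have h3 : (φ (r * 0)).re ≤ δ / 11808 := by
      rw [mul_zero]
      refine ((Complex.re_le_norm _).trans (norm_div_one_add_le (hre 0 h0))).trans ?_
      simpa using hbd 0 h0
    have h4 : CircleIntegrable (fun z => (9 : ℝ) • (φ (r * z)).re) 0 s := h1.const_smul
    calc _ ≤ Real.circleAverage (fun z => (9 : ℝ) • (φ (r * z)).re) 0 s := by
          refine Real.circleAverage_mono (circleIntegrable_norm_sq (hψd.mono hsub) hs hs1) h4
            fun z hz => ?_
          have h5 := norm_sq_div_one_add_le_re
            (hre _ (hrz z (hsub (sphere_subset_disc hs hs1 hz))))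
          rw [norm_mul, mul_pow, smul_eq_mul]
          have h6 : ‖C‖ ^ 2 ≤ 9 := by nlinarith [norm_nonneg C]
          gcongr
      _ = 9 * (φ (r * 0)).re := by rw [Real.circleAverage_fun_smul, h2, smul_eq_mul]
      _ ≤ δ := by linarith
  · have hW := measurable_W μ
    have h1 : ∀ z ∈ disc, ‖deriv (fun z => C * φ (r * z)) z‖ₑ ^ 2 * W μ z ≤
        9 * (‖deriv φ (r * z)‖ₑ ^ 2 * W μ z) := by
      intro z hz
      have h2 := (differentiableAt_of_disc hφd (hrz z (hsub hz))).hasDerivAt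
      have h3 : HasDerivAt (fun z => C * φ (r * z)) (C * (deriv φ (r * z) * r)) z :=
        ((h2.comp z ((hasDerivAt_id z).const_mul (r : ℂ))).const_mul C).congr_deriv (by simp)
      rw [h3.deriv, ← mul_assoc 9]
      gcongr ?_ * _
      have h4 : ‖C * (deriv φ (r * z) * r)‖ ≤ 3 * ‖deriv φ (r * z)‖ := by
        rw [norm_mul, norm_mul, Complex.norm_real, Real.norm_eq_abs, abs_of_pos hr0]
        gcongr
        exact mul_le_of_le_one_right (norm_nonneg _) hr1.le
      have h5 : ‖C * (deriv φ (r * z) * r)‖ₑ ≤ 3 * ‖deriv φ (r * z)‖ₑ := by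
        rw [← ofReal_norm, ← ofReal_norm, ← ENNReal.ofReal_ofNat 3,
          ← ENNReal.ofReal_mul (by norm_num)]
        exact ENNReal.ofReal_le_ofReal h4
      calc _ ≤ (3 * ‖deriv φ (r * z)‖ₑ) ^ 2 := by gcongr
        _ = _ := by rw [mul_pow]; norm_num
    have hann : ∀ R : ℝ, R < 0 → ann R = disc := fun R hR => by
      refine (ann_subset_disc R).antisymm fun z hz => ⟨hR.trans_le (norm_nonneg z), mem_disc.1 hz⟩
    have h2 := lintegral_dilation_le hμ (measurable_deriv φ) (hφd.deriv isOpen_ball) hrh hr1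
      (R := -1) (by linarith)
    rw [hann _ (by norm_num), hann _ (by norm_num)] at h2
    have m1 := measurable_deriv φ
    calc _ ≤ ∫⁻ z in disc, 9 * (‖deriv φ (r * z)‖ₑ ^ 2 * W μ z) :=
          setLIntegral_mono' measurableSet_disc h1
      _ = 9 * ∫⁻ z in disc, ‖deriv φ (r * z)‖ₑ ^ 2 * W μ z := lintegral_const_mul _ (by fun_prop)
      _ ≤ 9 * (1312 * ∫⁻ z in disc, ‖deriv f z‖ₑ ^ 2 * W μ z) := by
          gcongr 9 * ?_
          refine h2.trans ?_
          gcongr 1312 * ?_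
          refine setLIntegral_mono' measurableSet_disc fun z hz => ?_
          have := hφ' z hz
          gcongr
      _ ≤ 9 * (1312 * ENNReal.ofReal (δ / 11808)) := by gcongr
      _ = ENNReal.ofReal δ := by
          rw [← ENNReal.ofReal_ofNat 9, ← ENNReal.ofReal_ofNat 1312,
            ← ENNReal.ofReal_mul (by norm_num), ← ENNReal.ofReal_mul (by norm_num)]
          congr 1
          ring
  · have h1 := norm_div_one_add_le_one (hre _ (hrz z (hsub hz)))
    calc _ = ‖C‖ * ‖φ (r * z)‖ := norm_mul _ _
      _ ≤ 3 * 1 := by gcongr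
      _ = 3 := by norm_num
  · have hz1 := mem_disc.1 hz
    have h0 : 0 < 1 - ‖z‖ := by linarith
    have h1 := (norm_div_one_add_le (hre _ (hrz z (hsub hz)))).trans (hbd _ (hrz z (hsub hz)))
    have h2 : 1 - ‖z‖ ≤ 1 - ‖(r : ℂ) * z‖ := by
      rw [hrn]; nlinarith [norm_nonneg z]
    calc _ = ‖C‖ * ‖φ (r * z)‖ := norm_mul _ _
      _ ≤ 3 * (δ / 11808 / (1 - ‖(r : ℂ) * z‖)) := by gcongr
      _ ≤ 3 * (δ / 11808 / (1 - ‖z‖)) := by gcongr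
      _ = 3 / 11808 * (δ / (1 - ‖z‖)) := by ring
      _ ≤ δ / (1 - ‖z‖) := mul_le_of_le_one_left (by positivity) (by norm_num)

lemma exists_bound_of_differentiableOn_ball {g : ℂ → ℂ} {ρ : ℝ} (hρ : 1 < ρ)
    (hg : DifferentiableOn ℂ g (ball 0 ρ)) :
    ∃ A, (∀ z ∈ disc, ‖g z‖ ≤ A) ∧ ∀ z ∈ disc, ‖deriv g z‖ ≤ A := by
  have hsub : closedBall (0 : ℂ) 1 ⊆ ball 0 ρ := closedBall_subset_ball hρ
  have hc := isCompact_closedBall (0 : ℂ) 1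
  obtain ⟨A, hA⟩ := hc.exists_bound_of_continuousOn (hg.continuousOn.mono hsub)
  obtain ⟨B, hB⟩ := hc.exists_bound_of_continuousOn
    ((hg.deriv isOpen_ball).continuousOn.mono hsub)
  exact ⟨max A B, fun z hz => (hA z (ball_subset_closedBall hz)).trans (le_max_left _ _),
    fun z hz => (hB z (ball_subset_closedBall hz)).trans (le_max_right _ _)⟩

/-- If `c_μ({ζ}) = 0` then `[(z - ζ)ⁿ]_{D(μ)} = D(μ)`. -/
theorem closedSpan_pow_of_cap_zero
    (μ : Measure ℂ) [IsFiniteMeasure μ] (hμ : OnCircle μ)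
    (ζ : ℂ) (hζ : ζ ∈ circleT) (n : ℕ) (hn : 1 ≤ n)
    (hcap : cap μ {ζ} = 0) :
    closedSpan μ (fun z => (z - ζ) ^ n) = {g | MemD μ g} := by
  refine Subset.antisymm (fun g hg => hg.1) fun g (hg : MemD μ g) => ⟨hg, fun ε hε => ?_⟩
  have hζ1 : ‖ζ‖ = 1 := mem_sphere_zero_iff_norm.1 hζ
  have hε' : 0 < ε / 32 := by positivity
  obtain ⟨s, hs, hs0, hs1⟩ := ((eventually_small_dilation hμ hg hε').and
    (Ioo_mem_nhdsLT (zero_lt_one' ℝ))).exists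
  have hgs : DifferentiableOn ℂ (fun z => g (s * z)) (ball 0 (1 / s)) := by
    refine hg.1.1.comp (by fun_prop) fun z hz => ?_
    rw [mem_ball_zero_iff, lt_div_iff₀ hs0] at hz
    rw [mem_disc, norm_mul, Complex.norm_real, Real.norm_eq_abs, abs_of_pos hs0]
    linarith
  have hs' : 1 < 1 / s := (one_lt_div hs0).2 hs1
  obtain ⟨A, hA, hA'⟩ := exists_bound_of_differentiableOn_ball hs' hgs
  obtain ⟨δ, hδ, hmul⟩ := exists_small_mul hμ (hgs.mono (ball_subset_ball hs'.le)) hA hA' n hε'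
  obtain ⟨ψ, ρ, hρ, hψ, hψζ, hψS, hψ3, hψδ⟩ := exists_bump hμ hζ1 hcap hδ
  have h2 := hmul ψ hψS hψ3 hψδ
  have hζρ : ζ ∈ ball (0 : ℂ) ρ := by rw [mem_ball_zero_iff, hζ1]; exact hρ
  have hd : DifferentiableOn ℂ (fun z => (-dslope ψ ζ z) ^ n * g (s * z))
      (ball 0 (min ρ (1 / s))) :=
    ((((Complex.differentiableOn_dslope (isOpen_ball.mem_nhds hζρ)).2 hψ).mono
      (ball_subset_ball (min_le_left _ _))).neg.pow n).mul
      (hgs.mono (ball_subset_ball (min_le_right _ _)))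
  obtain ⟨q, h3⟩ := exists_polynomial_small hμ (lt_min hρ hs') hd ζ n hε'
  refine ⟨q, ?_⟩
  have hsum : (fun z => g z - q.eval z * (z - ζ) ^ n) = fun z => (g z - g (s * z)) +
      ((g (s * z) - (1 - ψ z) ^ n * g (s * z)) +
        ((z - ζ) ^ n * ((-dslope ψ ζ z) ^ n * g (s * z)) - q.eval z * (z - ζ) ^ n)) := by
    funext z
    have h4 : 1 - ψ z = (z - ζ) * -dslope ψ ζ z := by
      have := sub_smul_dslope ψ ζ z
      rw [smul_eq_mul, hψζ] at this
      linear_combination this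
    rw [h4, mul_pow]
    ring
  rw [hsum]
  have h5 := (hs.add (h2.add h3)).dNormSq_le hμ
  linarith

end DirichletMu
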